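/- arXiv:2203.00406 — 3 statements merged into one kernel-verified Lean document; each statement's English description precedes it below -/
import Mathlib

section
/- For m, n ≥ 2, every operator among ẽ_i, f̃_i (i ∈ {0,1,…,m−1}) commutes with every operator among ẽ^t_j, f̃^t_j (j ∈ {0,1,…,n−1}) as maps from M̂_{m×n} ∪ {0} to itself, where each operator sends 0 to 0: for all x, y ∈ {e, f}, all such i, j, and all A ∈ M̂_{m×n}, x̃_i(ỹ^t_j A) = ỹ^t_j(x̃_i A). -/
open scoped Classical

namespace AffineRSK

/-- `ℤ × ℤ`-matrices with non-negative integer entries. -/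
abbrev Mat : Type := ℤ → ℤ → ℕ

abbrev Cell : Type := ℤ × ℤ

/-- Generalized affine permutations of period `(m, n)`:
`a_{i+m, j+n} = a_{ij}` and each column has finite support. -/
def IsGAP (m n : ℕ) (A : Mat) : Prop :=
  (∀ i j : ℤ, A (i + m) (j + n) = A i j) ∧ ∀ j : ℤ, {i : ℤ | A i j ≠ 0}.Finite

/-- Generalized dual affine permutations: entries in `{0, 1}`. -/
def IsGDAP (m n : ℕ) (A : Mat) : Prop :=
  IsGAP m n A ∧ ∀ i j : ℤ, A i j ≤ 1

def supp (A : Mat) : Set Cell := {c : Cell | A c.1 c.2 ≠ 0}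

def tauC (m n : ℕ) (c : Cell) : Cell := (c.1 + (m : ℤ), c.2 + (n : ℤ))

/-- `NW c₁ c₂` means `c₁ >_NW c₂`. -/
def NW (c₁ c₂ : Cell) : Prop := c₁.1 < c₂.1 ∧ c₁.2 < c₂.2

/-- `nwGe c₁ c₂` means `c₁ ≥_nw c₂`. -/
def nwGe (c₁ c₂ : Cell) : Prop := c₁.1 ≤ c₂.1 ∧ c₁.2 ≤ c₂.2

/-- `neLe c₁ c₂` means `c₁ ≤_ne c₂`. -/
def neLe (c₁ c₂ : Cell) : Prop := c₂.1 ≤ c₁.1 ∧ c₁.2 ≤ c₂.2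

/-- `nWgt c₁ c₂` means `c₁ >_nW c₂` (dual order). -/
def nWgt (c₁ c₂ : Cell) : Prop := c₁.1 ≤ c₂.1 ∧ c₁.2 < c₂.2

/-- `NeLt c₁ c₂` means `c₁ <_Ne c₂` (dual order). -/
def NeLt (c₁ c₂ : Cell) : Prop := c₂.1 < c₁.1 ∧ c₁.2 ≤ c₂.2

/-- A proper numbering on `A`. -/
def IsProper (A : Mat) (d : Cell → ℤ) : Prop :=
  (∀ c₁ ∈ supp A, ∀ c₂ ∈ supp A, NW c₂ c₁ → d c₂ < d c₁) ∧
    ∀ c₁ ∈ supp A, ∃ c₂ ∈ supp A, NW c₂ c₁ ∧ d c₂ = d c₁ - 1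

/-- A dual proper numbering on `A`. -/
def IsProper' (A : Mat) (d : Cell → ℤ) : Prop :=
  (∀ c₁ ∈ supp A, ∀ c₂ ∈ supp A, nWgt c₂ c₁ → d c₂ < d c₁) ∧
    ∀ c₁ ∈ supp A, ∃ c₂ ∈ supp A, nWgt c₂ c₁ ∧ d c₂ = d c₁ - 1

/-- An enumeration of a stream of flow `l`. -/
def IsStreamEnum (m n : ℕ) (e : ℤ → Cell) (l : ℕ) : Prop :=
  0 < l ∧ (∀ i : ℤ, NW (e i) (e (i + 1))) ∧ ∀ i : ℤ, tauC m n (e i) = e (i + l)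

def IsStreamEnum' (m n : ℕ) (e : ℤ → Cell) (l : ℕ) : Prop :=
  0 < l ∧ (∀ i : ℤ, nWgt (e i) (e (i + 1))) ∧ ∀ i : ℤ, tauC m n (e i) = e (i + l)

def IsStream (m n : ℕ) (S : Set Cell) (l : ℕ) : Prop :=
  ∃ e : ℤ → Cell, IsStreamEnum m n e l ∧ Set.range e = S

def IsStream' (m n : ℕ) (S : Set Cell) (l : ℕ) : Prop :=
  ∃ e : ℤ → Cell, IsStreamEnum' m n e l ∧ Set.range e = S

/-- A channel of `A`: a stream contained in `supp A` of maximal flow. -/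
def IsChannel (m n : ℕ) (A : Mat) (C : Set Cell) : Prop :=
  ∃ l : ℕ, IsStream m n C l ∧ C ⊆ supp A ∧
    ∀ (S : Set Cell) (l' : ℕ), IsStream m n S l' → S ⊆ supp A → l' ≤ l

def IsChannel' (m n : ℕ) (A : Mat) (C : Set Cell) : Prop :=
  ∃ l : ℕ, IsStream' m n C l ∧ C ⊆ supp A ∧
    ∀ (S : Set Cell) (l' : ℕ), IsStream' m n S l' → S ⊆ supp A → l' ≤ l

def Csw (A : Mat) (C : Set Cell) : Set Cell :=
  {c ∈ supp A | ∃ c' ∈ C, neLe c c'}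

def Csw' (A : Mat) (C : Set Cell) : Set Cell :=
  {c ∈ supp A | c ∈ C ∨ ∃ c' ∈ C, NeLt c c'}

/-- `swGe A C₁ C₂` means `C₁ ≽_sw C₂`. -/
def swGe (A : Mat) (C₁ C₂ : Set Cell) : Prop := C₁ ⊆ Csw A C₂

def swGe' (A : Mat) (C₁ C₂ : Set Cell) : Prop := C₁ ⊆ Csw' A C₂

/-- The set of values `d₀(c'_k) + k` over `>_NW`-chains from `c` to the channel
enumerated by `e` (where `d₀ (e idx) = idx`). -/
def chainSet (A : Mat) (e : ℤ → Cell) (c : Cell) : Set ℤ :=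
  {v : ℤ | ∃ (k : ℕ) (ch : ℕ → Cell),
      ch 0 = c ∧ (∀ i ≤ k, ch i ∈ supp A) ∧ (∀ i < k, NW (ch (i + 1)) (ch i)) ∧
        ∃ idx : ℤ, e idx = ch k ∧ v = idx + (k : ℤ)}

def chainSet' (A : Mat) (e : ℤ → Cell) (c : Cell) : Set ℤ :=
  {v : ℤ | ∃ (k : ℕ) (ch : ℕ → Cell),
      ch 0 = c ∧ (∀ i ≤ k, ch i ∈ supp A) ∧ (∀ i < k, nWgt (ch (i + 1)) (ch i)) ∧
        ∃ idx : ℤ, e idx = ch k ∧ v = idx + (k : ℤ)}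

/-- `d` is the channel numbering `d^C_A` for the channel enumerated by `e`. -/
def IsChannelNumbering (A : Mat) (e : ℤ → Cell) (d : Cell → ℤ) : Prop :=
  ∀ c ∈ supp A, IsGreatest (chainSet A e c) (d c)

def IsChannelNumbering' (A : Mat) (e : ℤ → Cell) (d : Cell → ℤ) : Prop :=
  ∀ c ∈ supp A, IsGreatest (chainSet' A e c) (d c)

/-- `e` enumerates the southwest channel of `A`. -/
def IsSWChannelEnum (m n : ℕ) (A : Mat) (e : ℤ → Cell) : Prop :=
  (∃ l : ℕ, IsStreamEnum m n e l) ∧ IsChannel m n A (Set.range e) ∧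
    ∀ C : Set Cell, IsChannel m n A C → swGe A (Set.range e) C

def IsSWChannelEnum' (m n : ℕ) (A : Mat) (e : ℤ → Cell) : Prop :=
  (∃ l : ℕ, IsStreamEnum' m n e l) ∧ IsChannel' m n A (Set.range e) ∧
    ∀ C : Set Cell, IsChannel' m n A C → swGe' A (Set.range e) C

/-- `d` is a southwest channel numbering of `A`. -/
def IsSWNumbering (m n : ℕ) (A : Mat) (d : Cell → ℤ) : Prop :=
  ∃ e : ℤ → Cell, IsSWChannelEnum m n A e ∧ IsChannelNumbering A e d

def IsSWNumbering' (m n : ℕ) (A : Mat) (d : Cell → ℤ) : Prop :=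
  ∃ e : ℤ → Cell, IsSWChannelEnum' m n A e ∧ IsChannelNumbering' A e d

/-- A zig-zag: bi-infinite east/north lattice path, eventually east on the
right and coming from the south on the left. -/
def IsZigZag (z : ℤ → Cell) : Prop :=
  (∀ i : ℤ, z (i + 1) = ((z i).1, (z i).2 + 1) ∨ z (i + 1) = ((z i).1 - 1, (z i).2)) ∧
  (∃ N : ℤ, ∀ i : ℤ, N ≤ i → z (i + 1) = ((z i).1, (z i).2 + 1)) ∧
    ∃ N : ℤ, ∀ i : ℤ, i ≤ N → z (i + 1) = ((z i).1 - 1, (z i).2)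

def innerCorners (z : ℤ → Cell) : Set Cell :=
  {c : Cell | ∃ i : ℤ, z i = c ∧ z i = ((z (i - 1)).1 - 1, (z (i - 1)).2) ∧
      z (i + 1) = ((z i).1, (z i).2 + 1)}

def outerCorners (z : ℤ → Cell) : Set Cell :=
  {c : Cell | ∃ i : ℤ, z i = c ∧ z i = ((z (i - 1)).1, (z (i - 1)).2 + 1) ∧
      z (i + 1) = ((z i).1 - 1, (z i).2)}

def levelSet (A : Mat) (d : Cell → ℤ) (k : ℤ) : Set Cell := {c ∈ supp A | d c = k}

/-- `≥_nw`-maximal cells of `S`. -/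
def nwMaximal (S : Set Cell) : Set Cell := {c ∈ S | ∀ c' ∈ S, nwGe c' c → c' = c}

/-- `>_nW`-maximal cells of `S` (dual). -/
def nWMaximal (S : Set Cell) : Set Cell := {c ∈ S | ∀ c' ∈ S, ¬ nWgt c' c}

/-- `z` is the zig-zag at level `k` associated to the numbering `d`. -/
def ZigZagAt (A : Mat) (d : Cell → ℤ) (k : ℤ) (z : ℤ → Cell) : Prop :=
  IsZigZag z ∧ innerCorners z = nwMaximal (levelSet A d k)

def ZigZagAt' (A : Mat) (d : Cell → ℤ) (k : ℤ) (z : ℤ → Cell) : Prop :=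
  IsZigZag z ∧ innerCorners z = nWMaximal (levelSet A d k)

def IsInnerOf (A : Mat) (d : Cell → ℤ) (c : Cell) : Prop :=
  ∃ (k : ℤ) (z : ℤ → Cell), ZigZagAt A d k z ∧ c ∈ innerCorners z

def IsOuterOf (A : Mat) (d : Cell → ℤ) (c : Cell) : Prop :=
  ∃ (k : ℤ) (z : ℤ → Cell), ZigZagAt A d k z ∧ c ∈ outerCorners z

def IsInnerOf' (A : Mat) (d : Cell → ℤ) (c : Cell) : Prop :=
  ∃ (k : ℤ) (z : ℤ → Cell), ZigZagAt' A d k z ∧ c ∈ innerCorners z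

def IsOuterOf' (A : Mat) (d : Cell → ℤ) (c : Cell) : Prop :=
  ∃ (k : ℤ) (z : ℤ → Cell), ZigZagAt' A d k z ∧ c ∈ outerCorners z

/-- `B` is obtained from `A` by subtracting `1` at inner corners and adding `1`
at outer corners. -/
def FlatEntries (A B : Mat) (Inn Out : Cell → Prop) : Prop :=
  ∀ c : Cell,
    (Inn c → B c.1 c.2 + 1 = A c.1 c.2) ∧
    (Out c → B c.1 c.2 = A c.1 c.2 + 1) ∧
    (¬ Inn c → ¬ Out c → B c.1 c.2 = A c.1 c.2)

/-- `B = A^♭`. -/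
def FlatRel (m n : ℕ) (A B : Mat) : Prop :=
  ∃ d : Cell → ℤ, IsSWNumbering m n A d ∧
    FlatEntries A B (IsInnerOf A d) (IsOuterOf A d)

/-- `B = A^{♭'}` (dual). -/
def FlatRel' (m n : ℕ) (A B : Mat) : Prop :=
  ∃ d : Cell → ℤ, IsSWNumbering' m n A d ∧
    FlatEntries A B (IsInnerOf' A d) (IsOuterOf' A d)

/-- `c` is the back-post corner of the zig-zag `z`:
`(row of rightmost inner corner, column of leftmost inner corner)`. -/
def IsBackPost (z : ℤ → Cell) (c : Cell) : Prop :=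
  ∃ cr ∈ innerCorners z, ∃ cl ∈ innerCorners z,
    (∀ c' ∈ innerCorners z, c'.2 ≤ cr.2) ∧ (∀ c' ∈ innerCorners z, cl.2 ≤ c'.2) ∧
      c = (cr.1, cl.2)

def backPostSet (A : Mat) (d : Cell → ℤ) : Set Cell :=
  {c : Cell | ∃ (k : ℤ) (z : ℤ → Cell), ZigZagAt A d k z ∧ IsBackPost z c}

def backPostSet' (A : Mat) (d : Cell → ℤ) : Set Cell :=
  {c : Cell | ∃ (k : ℤ) (z : ℤ → Cell), ZigZagAt' A d k z ∧ IsBackPost z c}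

/-- Defining data `(a, b, r)` of the stream enumerated by `e` of flow `l`. -/
def StreamData (m n : ℕ) (e : ℤ → Cell) (l : ℕ) (a b : ℕ → ℤ) (r : ℤ) : Prop :=
  ∃ r₁ r₂ : ℤ,
    (∀ p : ℕ, p < l → a p = (e (r₁ + 1 + p)).1 ∧ 1 ≤ a p ∧ a p ≤ (m : ℤ)) ∧
    (∀ p : ℕ, p < l → b p = (e (r₂ + 1 + p)).2 ∧ 1 ≤ b p ∧ b p ≤ (n : ℤ)) ∧
      r = r₁ - r₂

/-- The matrix-ball iteration `A = A^(0), A^(t) = (A^(t-1))^♭`, with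
`A^(t) ≠ O` for `t < s` and `A^(s) = O`. -/
def MBCseq (m n : ℕ) (A : Mat) (s : ℕ) (Aseq : ℕ → Mat) : Prop :=
  Aseq 0 = A ∧ (∀ t < s, Aseq t ≠ 0) ∧ Aseq s = 0 ∧
    ∀ t < s, FlatRel m n (Aseq t) (Aseq (t + 1))

def MBCseq' (m n : ℕ) (A : Mat) (s : ℕ) (Aseq : ℕ → Mat) : Prop :=
  Aseq 0 = A ∧ (∀ t < s, Aseq t ≠ 0) ∧ Aseq s = 0 ∧
    ∀ t < s, FlatRel' m n (Aseq t) (Aseq (t + 1))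

/-- `κ₀(A) = (P, Q, ρ)`, with shape given by the column lengths `μ`:
the `t`-th columns (from the left, `0`-based) of `P` and `Q` are the defining
data of the stream of back-post corners of the zig-zags of `d^{sw}_{A^(t)}`. -/
def Kappa0Rel (m n : ℕ) (A : Mat) (s : ℕ) (μ : ℕ → ℕ) (P Q : ℕ → ℕ → ℤ)
    (ρ : ℕ → ℤ) : Prop :=
  ∃ Aseq : ℕ → Mat, MBCseq m n A s Aseq ∧
    ∀ t < s, ∃ (d : Cell → ℤ) (e : ℤ → Cell),
      IsSWNumbering m n (Aseq t) d ∧ IsStreamEnum m n e (μ t) ∧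
        Set.range e = backPostSet (Aseq t) d ∧
        StreamData m n e (μ t) (fun x => P x t) (fun x => Q x t) (ρ t)

def Kappa0Rel' (m n : ℕ) (A : Mat) (s : ℕ) (μ : ℕ → ℕ) (P Q : ℕ → ℕ → ℤ)
    (ρ : ℕ → ℤ) : Prop :=
  ∃ Aseq : ℕ → Mat, MBCseq' m n A s Aseq ∧
    ∀ t < s, ∃ (d : Cell → ℤ) (e : ℤ → Cell),
      IsSWNumbering' m n (Aseq t) d ∧ IsStreamEnum' m n e (μ t) ∧
        Set.range e = backPostSet' (Aseq t) d ∧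
        StreamData m n e (μ t) (fun x => P x t) (fun x => Q x t) (ρ t)

/-! ### Columns and the shift `τ` -/

/-- Extension of a column `c` of length `b` to `ℤ`: `c̃(x + bq) = c(x) + nq`. -/
def colExt (n b : ℕ) (c : ℕ → ℤ) (z : ℤ) : ℤ :=
  c (Int.toNat (Int.emod z (b : ℤ))) + (n : ℤ) * Int.ediv z (b : ℤ)

/-- `τ_n^k` applied to a column of length `b`. -/
def tauPow (n b : ℕ) (k : ℤ) (c : ℕ → ℤ) : ℕ → ℤ :=
  fun x => colExt n b c ((x : ℤ) + k)

/-- The two-column tableau `(column t of T, τ_N^r(column (t+1) of T))`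
(both of height `μ t`) is `ℤ`-semistandard. -/
def pairCond (N : ℕ) (μ : ℕ → ℕ) (T : ℕ → ℕ → ℤ) (t : ℕ) (r : ℕ) : Prop :=
  (∀ x : ℕ, x + 1 < μ t → T x t < T (x + 1) t) ∧
  (∀ x : ℕ, x + 1 < μ t →
    tauPow N (μ t) (r : ℤ) (fun y => T y (t + 1)) x <
      tauPow N (μ t) (r : ℤ) (fun y => T y (t + 1)) (x + 1)) ∧
    ∀ x < μ t, T x t ≤ tauPow N (μ t) (r : ℤ) (fun y => T y (t + 1)) x

/-- The offset `r` for the adjacent pair of columns `(t, t+1)`. -/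
noncomputable def rOff (N : ℕ) (μ : ℕ → ℕ) (T : ℕ → ℕ → ℤ) (t : ℕ) : ℕ :=
  sInf {r : ℕ | pairCond N μ T t r}

/-- Dual version: placing row `t` above row `τ_N^r(row (t+1))` (rows of the
transposed tableau, i.e. columns of `T`) is `ℤ`-semistandard. -/
def dualPairCond (N : ℕ) (μ : ℕ → ℕ) (T : ℕ → ℕ → ℤ) (t : ℕ) (r : ℕ) : Prop :=
  (∀ x : ℕ, x + 1 < μ t → T x t ≤ T (x + 1) t) ∧
  (∀ x : ℕ, x + 1 < μ t →
    tauPow N (μ t) (r : ℤ) (fun y => T y (t + 1)) x ≤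
      tauPow N (μ t) (r : ℤ) (fun y => T y (t + 1)) (x + 1)) ∧
    ∀ x < μ t, T x t < tauPow N (μ t) (r : ℤ) (fun y => T y (t + 1)) x

noncomputable def rOffDual (N : ℕ) (μ : ℕ → ℕ) (T : ℕ → ℕ → ℤ) (t : ℕ) : ℕ :=
  sInf {r : ℕ | dualPairCond N μ T t r}

/-- First column of the rectangle block containing column `t`. -/
noncomputable def blockStart (μ : ℕ → ℕ) (t : ℕ) : ℕ := sInf {t' : ℕ | μ t' = μ t}

/-- The symmetrized offset entry attached to column `t`
(`η_j` where `j` is the position of `t` from the right in its block). -/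
noncomputable def etaCol (N : ℕ) (μ : ℕ → ℕ) (T : ℕ → ℕ → ℤ) (t : ℕ) : ℕ :=
  ∑ u ∈ Finset.Ico (blockStart μ t) t, rOff N μ T u

noncomputable def etaColDual (N : ℕ) (μ : ℕ → ℕ) (T : ℕ → ℕ → ℤ) (t : ℕ) : ℕ :=
  ∑ u ∈ Finset.Ico (blockStart μ t) t, rOffDual N μ T u

/-- Entries outside the shape are normalized to `0`. -/
def PadZeroT (s : ℕ) (μ : ℕ → ℕ) (T : ℕ → ℕ → ℤ) : Prop :=
  ∀ x t : ℕ, s ≤ t ∨ μ t ≤ x → T x t = 0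

/-- `μ` encodes (the conjugate of) a partition `λ ∈ 𝒫_m ∩ 𝒫_n` with `s` columns. -/
def ShapeOK (m n s : ℕ) (μ : ℕ → ℕ) : Prop :=
  (∀ t : ℕ, t + 1 < s → μ (t + 1) ≤ μ t) ∧ (∀ t < s, 0 < μ t ∧ μ t ≤ m ∧ μ t ≤ n) ∧
    ∀ t : ℕ, s ≤ t → μ t = 0

/-- Dual shape condition: `λ ∈ 𝒫_n`. -/
def ShapeOK' (n s : ℕ) (μ : ℕ → ℕ) : Prop :=
  (∀ t : ℕ, t + 1 < s → μ (t + 1) ≤ μ t) ∧ (∀ t < s, 0 < μ t ∧ μ t ≤ n) ∧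
    ∀ t : ℕ, s ≤ t → μ t = 0

/-- `κ(A) = (P, Q)` where `Q` is obtained by shifting the `t`-th column of `Q₀`
by `τ_n^{ρ_t + η_t}` (`η` the symmetrized offset vector of `P₀`). -/
def KappaRel (m n : ℕ) (A : Mat) (s : ℕ) (μ : ℕ → ℕ) (P Q : ℕ → ℕ → ℤ) : Prop :=
  ∃ (P' Q' : ℕ → ℕ → ℤ) (ρ : ℕ → ℤ),
    Kappa0Rel m n A s μ P' Q' ρ ∧
    (∀ t < s, ∀ x < μ t,
      P x t = P' x t ∧
        Q x t = tauPow n (μ t) (ρ t + (etaCol m μ P' t : ℤ)) (fun y => Q' y t) x) ∧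
    PadZeroT s μ P ∧ PadZeroT s μ Q ∧ ∀ t : ℕ, s ≤ t → μ t = 0

def KappaRel' (m n : ℕ) (A : Mat) (s : ℕ) (μ : ℕ → ℕ) (P Q : ℕ → ℕ → ℤ) : Prop :=
  ∃ (P' Q' : ℕ → ℕ → ℤ) (ρ : ℕ → ℤ),
    Kappa0Rel' m n A s μ P' Q' ρ ∧
    (∀ t < s, ∀ x < μ t,
      P x t = P' x t ∧
        Q x t = tauPow n (μ t) (ρ t + (etaColDual m μ P' t : ℤ)) (fun y => Q' y t) x) ∧
    PadZeroT s μ P ∧ PadZeroT s μ Q ∧ ∀ t : ℕ, s ≤ t → μ t = 0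

/-- Membership in `⨆_{λ ∈ 𝒫_m ∩ 𝒫_n} CSST_[m](λ) × B_n(λ)`:
`P` is column semistandard with entries in `{1, …, m}` and `Q` is a
`ℤ`-semistandard filling whose columns span less than `n` and whose rows
weakly increase within each rectangle block. -/
def InTargetRSK (m n s : ℕ) (μ : ℕ → ℕ) (P Q : ℕ → ℕ → ℤ) : Prop :=
  ShapeOK m n s μ ∧ PadZeroT s μ P ∧ PadZeroT s μ Q ∧
  (∀ t < s, ∀ x : ℕ, x + 1 < μ t → P x t < P (x + 1) t) ∧
  (∀ t < s, ∀ x < μ t, 1 ≤ P x t ∧ P x t ≤ (m : ℤ)) ∧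
  (∀ t < s, ∀ x : ℕ, x + 1 < μ t → Q x t < Q (x + 1) t) ∧
  (∀ t < s, Q (μ t - 1) t - Q 0 t < (n : ℤ)) ∧
    ∀ t : ℕ, t + 1 < s → μ t = μ (t + 1) → ∀ x < μ t, Q x t ≤ Q x (t + 1)

/-- Membership in `⨆_{λ ∈ 𝒫_n} RSST_[m](λ') × B_n(λ)`; the first component is
encoded by `P = P₀` (whose columns, weakly increasing with entries in
`{1, …, m}`, are the rows of `P₀ᵗ ∈ RSST_[m](λ')`). -/
def InTargetDual (m n s : ℕ) (μ : ℕ → ℕ) (P Q : ℕ → ℕ → ℤ) : Prop :=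
  ShapeOK' n s μ ∧ PadZeroT s μ P ∧ PadZeroT s μ Q ∧
  (∀ t < s, ∀ x : ℕ, x + 1 < μ t → P x t ≤ P (x + 1) t) ∧
  (∀ t < s, ∀ x < μ t, 1 ≤ P x t ∧ P x t ≤ (m : ℤ)) ∧
  (∀ t < s, ∀ x : ℕ, x + 1 < μ t → Q x t < Q (x + 1) t) ∧
  (∀ t < s, Q (μ t - 1) t - Q 0 t < (n : ℤ)) ∧
    ∀ t : ℕ, t + 1 < s → μ t = μ (t + 1) → ∀ x < μ t, Q x t ≤ Q x (t + 1)

/-- Dominance of a triple `(P, Q, ρ)`: within each rectangle block, the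
sequence `ρ - ζ` (read right to left) is weakly decreasing, where
`ζ = θ - η` with `η`, `θ` the symmetrized offset vectors of `P`, `Q`. -/
def Dominant (m n s : ℕ) (μ : ℕ → ℕ) (P Q : ℕ → ℕ → ℤ) (ρ : ℕ → ℤ) : Prop :=
  ∀ t : ℕ, t + 1 < s → μ t = μ (t + 1) →
    ρ t - ((etaCol n μ Q t : ℤ) - (etaCol m μ P t : ℤ)) ≤
      ρ (t + 1) - ((etaCol n μ Q (t + 1) : ℤ) - (etaCol m μ P (t + 1) : ℤ))

/-- `κ₀(A) = (P, Q, ρ)` with all data normalized outside the shape. -/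
def Kappa0RelPad (m n : ℕ) (A : Mat) (s : ℕ) (μ : ℕ → ℕ) (P Q : ℕ → ℕ → ℤ)
    (ρ : ℕ → ℤ) : Prop :=
  ∃ P' Q' : ℕ → ℕ → ℤ,
    Kappa0Rel m n A s μ P' Q' ρ ∧
    (∀ t < s, ∀ x < μ t, P x t = P' x t ∧ Q x t = Q' x t) ∧
    PadZeroT s μ P ∧ PadZeroT s μ Q ∧ (∀ t : ℕ, s ≤ t → μ t = 0) ∧
      ∀ t : ℕ, s ≤ t → ρ t = 0

/-- Membership in `Ω_dom`. -/
def InOmegaDom (m n s : ℕ) (μ : ℕ → ℕ) (P Q : ℕ → ℕ → ℤ) (ρ : ℕ → ℤ) : Prop :=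
  ShapeOK m n s μ ∧ PadZeroT s μ P ∧ PadZeroT s μ Q ∧ (∀ t : ℕ, s ≤ t → ρ t = 0) ∧
  (∀ t < s, ∀ x : ℕ, x + 1 < μ t → P x t < P (x + 1) t) ∧
  (∀ t < s, ∀ x < μ t, 1 ≤ P x t ∧ P x t ≤ (m : ℤ)) ∧
  (∀ t < s, ∀ x : ℕ, x + 1 < μ t → Q x t < Q (x + 1) t) ∧
  (∀ t < s, ∀ x < μ t, 1 ≤ Q x t ∧ Q x t ≤ (n : ℤ)) ∧
    Dominant m n s μ P Q ρ

/-- `A` has width `l`: some proper numbering has period `l`. -/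
def HasWidth (m n : ℕ) (A : Mat) (l : ℕ) : Prop :=
  ∃ d : Cell → ℤ, IsProper A d ∧ ∀ c ∈ supp A, d (tauC m n c) = d c + (l : ℤ)

/-! ### Crystal operators on matrices -/

/-- The first `+` of column `j` (row `i`) survives the signature reduction of
the sequence `σ` attached to rows `i, i+1`. -/
def SurvPlus (A : Mat) (i j : ℤ) : Prop :=
  0 < A i j ∧ ∀ j' : ℤ, j < j' →
    (∑ t ∈ Finset.Ioc j j', A (i + 1) t) ≤ (A i j - 1) + ∑ t ∈ Finset.Ioo j j', A i t

/-- The last `-` of column `j` (row `i+1`) survives the reduction. -/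
def SurvMinus (A : Mat) (i j : ℤ) : Prop :=
  0 < A (i + 1) j ∧ ∀ j' : ℤ, j' < j →
    (∑ t ∈ Finset.Ico j' j, A i t) ≤ (A (i + 1) j - 1) + ∑ t ∈ Finset.Ioo j' j, A (i + 1) t

/-- `A - Ê_{i₁ j} + Ê_{i₂ j}`. -/
noncomputable def subAddAt (m n : ℕ) (i₁ i₂ j : ℤ) (A : Mat) : Mat :=
  fun x y =>
    if ∃ k : ℤ, x = i₁ + k * m ∧ y = j + k * n then A x y - 1
    else if ∃ k : ℤ, x = i₂ + k * m ∧ y = j + k * n then A x y + 1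
    else A x y

/-- `f̃_i` on `M̂_{m×n}`, `0`-valued results encoded by `none`. -/
noncomputable def fMat (m n : ℕ) (i : ℤ) (A : Mat) : Option Mat :=
  if h : ∃ j : ℤ, SurvPlus A i j ∧ ∀ j' : ℤ, SurvPlus A i j' → j ≤ j' then
    some (subAddAt m n i (i + 1) h.choose A)
  else none

/-- `ẽ_i` on `M̂_{m×n}`. -/
noncomputable def eMat (m n : ℕ) (i : ℤ) (A : Mat) : Option Mat :=
  if h : ∃ j : ℤ, SurvMinus A i j ∧ ∀ j' : ℤ, SurvMinus A i j' → j' ≤ j then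
    some (subAddAt m n (i + 1) i h.choose A)
  else none

def transM (A : Mat) : Mat := fun i j => A j i

/-- `f̃^t_j A = (f̃_j (Aᵗ))ᵗ`. -/
noncomputable def fMatT (m n : ℕ) (j : ℤ) (A : Mat) : Option Mat :=
  (fMat n m j (transM A)).map transM

/-- `ẽ^t_j A = (ẽ_j (Aᵗ))ᵗ`. -/
noncomputable def eMatT (m n : ℕ) (j : ℤ) (A : Mat) : Option Mat :=
  (eMat n m j (transM A)).map transM

/-- Row operator (`f̃_i` if `x = true`, `ẽ_i` if `x = false`) on `M̂ ∪ {0}`. -/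
noncomputable def rowOp (m n : ℕ) (x : Bool) (i : ℤ) (o : Option Mat) : Option Mat :=
  o.bind (if x then fMat m n i else eMat m n i)

/-- Column operator (`f̃^t_j` or `ẽ^t_j`) on `M̂ ∪ {0}`. -/
noncomputable def colOp (m n : ℕ) (y : Bool) (j : ℤ) (o : Option Mat) : Option Mat :=
  o.bind (if y then fMatT m n j else eMatT m n j)

/-- The `+` of row `u`, column `j` survives the signature reduction of the
sequence attached to columns `j, j+1` (read along rows, top to bottom). -/
def ColSurvPlus (A : Mat) (j u : ℤ) : Prop :=
  0 < A u j ∧ ∀ u' : ℤ, u < u' →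
    (∑ i ∈ Finset.Ioc u u', A i (j + 1)) ≤ (A u j - 1) + ∑ i ∈ Finset.Ioo u u', A i j

/-- `A - Ê_{u j} + Ê_{u, j+1}`, the result of `f̃^t_j` acting at row `u`. -/
noncomputable def ftApply (m n : ℕ) (u j : ℤ) (A : Mat) : Mat :=
  fun x y =>
    if ∃ k : ℤ, x = u + k * m ∧ y = j + k * n then A x y - 1
    else if ∃ k : ℤ, x = u + k * m ∧ y = j + 1 + k * n then A x y + 1
    else A x y

/-! ### Crystal operators on tableaux -/

/-- Column `t` of `P` contributes a `+` for the letter `i`. -/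
def PhasPlus (μ : ℕ → ℕ) (P : ℕ → ℕ → ℤ) (i : ℤ) (t : ℕ) : Prop :=
  (∃ x < μ t, P x t = i) ∧ ∀ x < μ t, P x t ≠ i + 1

/-- Column `t` of `P` contributes a `-` for the letter `i`. -/
def PhasMinus (μ : ℕ → ℕ) (P : ℕ → ℕ → ℤ) (i : ℤ) (t : ℕ) : Prop :=
  (∃ x < μ t, P x t = i + 1) ∧ ∀ x < μ t, P x t ≠ i

/-- The `+` of column `t` survives the tensor-product signature reduction
(factors are the columns read from right to left). -/
def PSurvPlus (μ : ℕ → ℕ) (P : ℕ → ℕ → ℤ) (i : ℤ) (t : ℕ) : Prop :=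
  PhasPlus μ P i t ∧ ∀ t' < t,
    ((Finset.Ico t' t).filter (fun u => PhasMinus μ P i u)).card ≤
      ((Finset.Ioo t' t).filter (fun u => PhasPlus μ P i u)).card

def PSurvMinus (μ : ℕ → ℕ) (P : ℕ → ℕ → ℤ) (i : ℤ) (t : ℕ) : Prop :=
  PhasMinus μ P i t ∧ ∀ t'' : ℕ, t < t'' →
    ((Finset.Ioc t t'').filter (fun u => PhasPlus μ P i u)).card ≤
      ((Finset.Ioo t t'').filter (fun u => PhasMinus μ P i u)).card

/-- `f̃_i` on `P` acting on column `t₀` (replace the letter `i` by `i + 1`). -/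
noncomputable def applyPF (μ : ℕ → ℕ) (P : ℕ → ℕ → ℤ) (i : ℤ) (t₀ : ℕ) :
    ℕ → ℕ → ℤ :=
  fun x t => if t = t₀ ∧ x < μ t ∧ P x t = i then i + 1 else P x t

/-- `ẽ_i` on `P` acting on column `t₀`. -/
noncomputable def applyPE (μ : ℕ → ℕ) (P : ℕ → ℕ → ℤ) (i : ℤ) (t₀ : ℕ) :
    ℕ → ℕ → ℤ :=
  fun x t => if t = t₀ ∧ x < μ t ∧ P x t = i + 1 then i else P x t

/-- The entry at position `k` of a column `c` of height `b` can be increased. -/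
def QmovUp (n b : ℕ) (c : ℕ → ℤ) (k : ℕ) : Prop :=
  (k + 1 < b ∧ c k + 1 < c (k + 1)) ∨ (k + 1 = b ∧ c (b - 1) < c 0 + (n : ℤ) - 1)

/-- The entry at position `k` of a column `c` of height `b` can be decreased. -/
def QmovDown (n b : ℕ) (c : ℕ → ℤ) (k : ℕ) : Prop :=
  (0 < k ∧ c (k - 1) < c k - 1) ∨ (k = 0 ∧ c (b - 1) < c 0 + (n : ℤ) - 1)

def QhasPlus (n : ℕ) (μ : ℕ → ℕ) (Q : ℕ → ℕ → ℤ) (j : ℤ) (t : ℕ) : Prop :=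
  ∃ k < μ t, Int.emod (Q k t) (n : ℤ) = j ∧ QmovUp n (μ t) (fun y => Q y t) k

def QhasMinus (n : ℕ) (μ : ℕ → ℕ) (Q : ℕ → ℕ → ℤ) (j : ℤ) (t : ℕ) : Prop :=
  ∃ k < μ t, Int.emod (Q k t) (n : ℤ) = Int.emod (j + 1) (n : ℤ) ∧
    QmovDown n (μ t) (fun y => Q y t) k

def QSurvPlus (n : ℕ) (μ : ℕ → ℕ) (Q : ℕ → ℕ → ℤ) (j : ℤ) (t : ℕ) : Prop :=
  QhasPlus n μ Q j t ∧ ∀ t' < t,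
    ((Finset.Ico t' t).filter (fun u => QhasMinus n μ Q j u)).card ≤
      ((Finset.Ioo t' t).filter (fun u => QhasPlus n μ Q j u)).card

def QSurvMinus (n : ℕ) (μ : ℕ → ℕ) (Q : ℕ → ℕ → ℤ) (j : ℤ) (t : ℕ) : Prop :=
  QhasMinus n μ Q j t ∧ ∀ t'' : ℕ, t < t'' →
    ((Finset.Ioc t t'').filter (fun u => QhasPlus n μ Q j u)).card ≤
      ((Finset.Ioo t t'').filter (fun u => QhasMinus n μ Q j u)).card

/-- `f̃^t_j` on `Q` acting on column `t₀`. -/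
noncomputable def applyQF (n : ℕ) (μ : ℕ → ℕ) (Q : ℕ → ℕ → ℤ) (j : ℤ) (t₀ : ℕ) :
    ℕ → ℕ → ℤ :=
  fun x t =>
    if t = t₀ ∧ x < μ t ∧ Int.emod (Q x t) (n : ℤ) = j ∧
        QmovUp n (μ t) (fun y => Q y t) x
    then Q x t + 1 else Q x t

/-- `ẽ^t_j` on `Q` acting on column `t₀`. -/
noncomputable def applyQE (n : ℕ) (μ : ℕ → ℕ) (Q : ℕ → ℕ → ℤ) (j : ℤ) (t₀ : ℕ) :
    ℕ → ℕ → ℤ :=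
  fun x t =>
    if t = t₀ ∧ x < μ t ∧ Int.emod (Q x t) (n : ℤ) = Int.emod (j + 1) (n : ℤ) ∧
        QmovDown n (μ t) (fun y => Q y t) x
    then Q x t - 1 else Q x t

/-! ### Standardization -/

noncomputable def rowSumA (A : Mat) (i : ℤ) : ℕ := ∑ᶠ j : ℤ, A i j

noncomputable def colSumA (A : Mat) (j : ℤ) : ℕ := ∑ᶠ i : ℤ, A i j

/-- `A ∈ M̂_{m×n}(α, β)`. -/
def InMhatAB (m n : ℕ) (α β : ℕ → ℕ) (A : Mat) : Prop :=
  IsGAP m n A ∧ (∀ i : ℕ, 1 ≤ i → i ≤ m → rowSumA A i = α i) ∧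
    ∀ j : ℕ, 1 ≤ j → j ≤ n → colSumA A j = β j

/-- Extended affine permutations `W̃_K`. -/
def IsEAP (K : ℕ) (B : Mat) : Prop :=
  IsGAP K K B ∧ (∀ i j : ℤ, B i j ≤ 1) ∧ (∀ i : ℤ, ∃! j : ℤ, B i j ≠ 0) ∧
    ∀ j : ℤ, ∃! i : ℤ, B i j ≠ 0

/-- `i` is a descent of the matrix `B`. -/
def IsDescentM (B : Mat) (i : ℤ) : Prop :=
  ∃ j j' : ℤ, B i j ≠ 0 ∧ B (i + 1) j' ≠ 0 ∧ j' < j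

/-- Partial sums `α₁ + ⋯ + α_i`. -/
def psum (α : ℕ → ℕ) (i : ℕ) : ℕ := ∑ u ∈ Finset.Icc 1 i, α u

/-- `B` is `α`-descending. -/
def AlphaDescending (m : ℕ) (α : ℕ → ℕ) (B : Mat) : Prop :=
  ∀ k : ℕ, 1 ≤ k → k ≤ m → ∀ i : ℤ,
    (psum α (k - 1) : ℤ) < i → i < (psum α k : ℤ) → IsDescentM B i

/-- `B` is `(α, β)`-descending. -/
def IsABDescending (m n : ℕ) (α β : ℕ → ℕ) (B : Mat) : Prop :=
  AlphaDescending m α B ∧ AlphaDescending n β (transM B)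

/-- `B` standardizes `A`: blockwise entry sums of `B` over `𝓘_i × 𝓙_j`
equal the entries of `A`. -/
def PermOf (m n K : ℕ) (α β : ℕ → ℕ) (A B : Mat) : Prop :=
  ∀ (i₀ j₀ : ℕ) (q r : ℤ), 1 ≤ i₀ → i₀ ≤ m → 1 ≤ j₀ → j₀ ≤ n →
    A ((i₀ : ℤ) + q * m) ((j₀ : ℤ) + r * n) =
      ∑ k ∈ Finset.Icc ((psum α (i₀ - 1) : ℤ) + q * K + 1) ((psum α i₀ : ℤ) + q * K),
        ∑ l ∈ Finset.Icc ((psum β (j₀ - 1) : ℤ) + r * K + 1) ((psum β j₀ : ℤ) + r * K),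
          B k l

/-- Standardization of a column-semistandard tableau: for each value `v`, its
occurrences, from left to right, are replaced by consecutive integers starting
after the number of strictly smaller entries. -/
noncomputable def stdT (s : ℕ) (μ : ℕ → ℕ) (T : ℕ → ℕ → ℤ) : ℕ → ℕ → ℤ :=
  fun x t =>
    ((∑ t' ∈ Finset.range s,
        ((Finset.range (μ t')).filter (fun x' => T x' t' < T x t)).card : ℕ) : ℤ) +
      (((Finset.range t).filter (fun t' => ∃ x' < μ t', T x' t' = T x t)).card : ℤ) + 1

/-- `i` is a (column) descent of the tableau `T`: the letter `i + 1` occurs in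
a column strictly to the right of the column containing `i`. -/
def IsDescentT (s : ℕ) (μ : ℕ → ℕ) (T : ℕ → ℕ → ℤ) (i : ℤ) : Prop :=
  ∃ t < s, ∃ t' < s, ∃ x < μ t, ∃ x' < μ t', T x t = i ∧ T x' t' = i + 1 ∧ t < t'

/-! ### Rectangles, `B_n(R)` and `B_n(R)₀` (columns indexed from the right) -/

/-- `T ∈ B_n(R)` for the rectangle `R = (a^b)`; `T j x` is the entry at row `x`
of the `(j+1)`-st column from the right, normalized to `0` outside the shape. -/
def InBnR (n a b : ℕ) (T : ℕ → ℕ → ℤ) : Prop :=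
  (∀ j : ℕ, j + 1 < a → ∀ x < b, T (j + 1) x ≤ T j x) ∧
  (∀ j < a, ∀ x : ℕ, x + 1 < b → T j x < T j (x + 1)) ∧
  (∀ j < a, T j (b - 1) - T j 0 < (n : ℤ)) ∧
    ∀ j x : ℕ, a ≤ j ∨ b ≤ x → T j x = 0

/-- `T ∈ B_n(R)₀`: `(T^{j+1}, τ_n^{-1}(T^j))` is not semistandard for any `j`. -/
def InBnR0 (n a b : ℕ) (T : ℕ → ℕ → ℤ) : Prop :=
  InBnR n a b T ∧
    ∀ j : ℕ, j + 1 < a → ¬ ∀ x < b, T (j + 1) x ≤ tauPow n b (-1) (fun y => T j y) x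

/-- `ν ∈ 𝒫_{a-1}`: a partition `ν₁ ≥ ⋯ ≥ ν_{a-1} ≥ 0`, normalized. -/
def IsPartLen (a : ℕ) (ν : ℕ → ℕ) : Prop :=
  ν 0 = 0 ∧ (∀ j : ℕ, 1 ≤ j → j + 2 ≤ a → ν (j + 1) ≤ ν j) ∧ ∀ j : ℕ, a ≤ j → ν j = 0

/-- `(T, ν) ↦ τ_n^{ν_rev}(T)`: the column `j` (from the right, 0-based) is
shifted by `τ_n^{ν_{j+1}}`. -/
noncomputable def PhiMap (n a b : ℕ) (T : ℕ → ℕ → ℤ) (ν : ℕ → ℕ) : ℕ → ℕ → ℤ :=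
  fun j x => if j < a ∧ x < b then tauPow n b ((ν (j + 1) : ℤ)) (fun y => T j y) x else 0

/-- The offset `r_j` of `T` (columns from the right, paper indexing `j ≥ 1`). -/
noncomputable def rOffR (n b : ℕ) (T : ℕ → ℕ → ℤ) (j : ℕ) : ℕ :=
  sInf {r : ℕ | ∀ x < b, T j x ≤ tauPow n b ((r : ℤ)) (fun y => T (j - 1) y) x}

/-- The symmetrized offset `η_j = r_j + ⋯ + r_{a-1}`. -/
noncomputable def etaR (n a b : ℕ) (T : ℕ → ℕ → ℤ) (j : ℕ) : ℕ :=
  ∑ u ∈ Finset.Icc j (a - 1), rOffR n b T u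

/-! ### The two-column setup -/

/-- Row coordinates of the stream with defining data `(a, ·, ρ)`:
`X(p + ρ + ql) = a(p) + qm` for `1 ≤ p ≤ l`. -/
def streamX (m l : ℕ) (a : ℕ → ℤ) (ρ : ℤ) (idx : ℤ) : ℤ := colExt m l a (idx - ρ - 1)

/-- Column coordinates: `Y(p + ql) = b(p) + qn` for `1 ≤ p ≤ l`. -/
def streamY (n l : ℕ) (b : ℕ → ℤ) (idx : ℤ) : ℤ := colExt n l b (idx - 1)

/-- The matrix built from the interleaved streams `t` and `t'`. -/
noncomputable def twoColMat (m n l : ℕ) (a1 a2 b1 b2 : ℕ → ℤ) (ρ₁ ρ₂ k : ℤ) : Mat :=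
  fun x y =>
    (if ∃ i : ℤ, streamX m l a2 ρ₂ (i + k) = x ∧ streamY n l b1 i = y then 1 else 0) +
      (if ∃ i : ℤ, streamX m l a1 ρ₁ i = x ∧ streamY n l b2 (i + k) = y then 1 else 0)


/-! ### Auxiliary material for the proof -/

def ArgX (x : Bool) (h : ℤ → ℤ) (t : ℤ) : Prop :=
  ∀ s, h t ≤ h s ∧ ((if x then t < s else s < t) → h t < h s)

def IsH (A : Mat) (i : ℤ) (h : ℤ → ℤ) : Prop :=
  ∀ t, h (t + 1) - h t = (A i t : ℤ) - A (i + 1) (t + 1)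

noncomputable def Orb (m n : ℕ) (a b r c : ℤ) : ℤ :=
  if ∃ k : ℤ, r = a + k * m ∧ c = b + k * n then 1 else 0

def epsX (x : Bool) : ℤ := if x then 1 else -1

def Mv (m n : ℕ) (x : Bool) (i t : ℤ) (A B : Mat) : Prop :=
  ∀ r c, (B r c : ℤ) = A r c + epsX x * (Orb m n (i + 1) t r c - Orb m n i t r c)

def PerM (m n : ℕ) (A : Mat) : Prop := ∀ i j : ℤ, A (i + m) (j + n) = A i j

lemma PerM.mul {m n : ℕ} {A : Mat} (h : PerM m n A) (k i j : ℤ) :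
    A (i + k * m) (j + k * n) = A i j := by
  induction k using Int.induction_on with
  | zero => simp
  | succ k ih =>
    rw [← ih, ← h (i + k * m) (j + k * n)]; congr 1 <;> ring
  | pred k ih =>
    rw [← ih, ← h (i + (-k - 1) * m) (j + (-k - 1) * n)]; congr 1 <;> ring

lemma PerM.trans {m n : ℕ} {A : Mat} (h : PerM m n A) : PerM n m (transM A) :=
  fun i j => h j i

lemma Orb_trans (m n : ℕ) (a b r c : ℤ) : Orb m n a b r c = Orb n m b a c r := by
  unfold Orb; congr 1; simp only [and_comm]

lemma Orb_shift (m n : ℕ) (l a b r c : ℤ) :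
    Orb m n (a + l * m) (b + l * n) r c = Orb m n a b r c := by
  unfold Orb
  congr 1
  apply propext
  constructor
  · rintro ⟨k, h1, h2⟩; exact ⟨k + l, by rw [h1]; ring, by rw [h2]; ring⟩
  · rintro ⟨k, h1, h2⟩; exact ⟨k - l, by rw [h1]; ring, by rw [h2]; ring⟩

lemma Orb_per (m n : ℕ) (a b r c : ℤ) :
    Orb m n a b (r + m) (c + n) = Orb m n a b r c := by
  unfold Orb
  congr 1
  apply propext
  constructor
  · rintro ⟨k, h1, h2⟩; exact ⟨k - 1, by linarith, by linarith⟩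
  · rintro ⟨k, h1, h2⟩; exact ⟨k + 1, by linarith, by linarith⟩

lemma Orb_same (m n : ℕ) (hn : 0 < n) (a b r : ℤ) :
    Orb m n a b r b = if r = a then 1 else 0 := by
  unfold Orb
  congr 1
  apply propext
  constructor
  · rintro ⟨k, h1, h2⟩
    have : k * (n : ℤ) = 0 := by linarith
    have hk : k = 0 := by
      rcases mul_eq_zero.1 this with h | h
      · exact h
      · omega
    simpa [hk] using h1
  · rintro rfl; exact ⟨0, by simp⟩

lemma Orb_diff (m n : ℕ) (a b r c : ℤ) (h : ∀ k : ℤ, c ≠ b + k * n) :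
    Orb m n a b r c = 0 := by
  unfold Orb
  rw [if_neg]
  rintro ⟨k, _, h2⟩
  exact h k h2

lemma Mv.per {m n : ℕ} {x : Bool} {i t : ℤ} {A B : Mat} (hA : PerM m n A)
    (h : Mv m n x i t A B) : PerM m n B := by
  intro r c
  have h1 := h (r + m) (c + n)
  have h2 := h r c
  rw [Orb_per, Orb_per, hA] at h1
  exact_mod_cast h1.trans h2.symm

lemma exists_IsH (A : Mat) (i : ℤ) : ∃ h, IsH A i h := by
  let D : ℤ → ℤ := fun t => (A i t : ℤ) - A (i + 1) (t + 1)
  refine ⟨fun t => ∑ s ∈ Finset.Ico 0 t, D s - ∑ s ∈ Finset.Ico t 0, D s, fun t => ?_⟩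
  show _ = D t
  rcases le_or_gt 0 t with h | h
  · have e1 : Finset.Ico 0 (t + 1) = insert t (Finset.Ico 0 t) := by ext; simp; omega
    have e2 : Finset.Ico t 0 = ∅ := by ext; simp; omega
    have e3 : Finset.Ico (t + 1) 0 = ∅ := by ext; simp; omega
    simp only [e1, e2, e3]
    rw [Finset.sum_insert (by simp)]
    simp
  · have e1 : Finset.Ico t 0 = insert t (Finset.Ico (t + 1) 0) := by ext; simp; omega
    have e2 : Finset.Ico 0 t = ∅ := by ext; simp; omega
    have e3 : Finset.Ico 0 (t + 1) = ∅ := by ext; simp; omega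
    simp only [e1, e2, e3]
    rw [Finset.sum_insert (by simp)]
    simp

lemma ArgX.unique {x : Bool} {h : ℤ → ℤ} {s t : ℤ} (hs : ArgX x h s) (ht : ArgX x h t) :
    s = t := by
  have a := hs t
  have b := ht s
  cases x <;> simp at a b <;> by_contra hne <;> omega

lemma sum_H {A : Mat} {i : ℤ} {h : ℤ → ℤ} (hh : IsH A i h) (j : ℤ) (d : ℕ) :
    h (j + d + 1) - h j = (∑ t ∈ Finset.Ico j (j + d + 1), (A i t : ℤ)) -
      ∑ t ∈ Finset.Ioc j (j + d + 1), (A (i + 1) t : ℤ) := by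
  induction d with
  | zero =>
    have e1 : Finset.Ico j (j + 1) = {j} := by ext; simp; omega
    have e2 : Finset.Ioc j (j + 1) = {j + 1} := by ext; simp; omega
    simp [e1, e2, hh j]
  | succ d ih =>
    have e1 : Finset.Ico j (j + (d + 1 : ℕ) + 1)
        = insert (j + d + 1) (Finset.Ico j (j + d + 1)) := by ext; simp; omega
    have e2 : Finset.Ioc j (j + (d + 1 : ℕ) + 1)
        = insert (j + d + 1 + 1) (Finset.Ioc j (j + d + 1)) := by ext; simp; omega
    rw [e1, e2, Finset.sum_insert (by simp), Finset.sum_insert (by simp)]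
    have := hh (j + d + 1)
    have e3 : j + (d + 1 : ℕ) + 1 = j + d + 1 + 1 := by push_cast; ring
    rw [e3]
    linarith

lemma sum_H' {A : Mat} {i : ℤ} {h : ℤ → ℤ} (hh : IsH A i h) {j j' : ℤ} (hj : j < j') :
    h j' - h j = (∑ t ∈ Finset.Ico j j', (A i t : ℤ)) -
      ∑ t ∈ Finset.Ioc j j', (A (i + 1) t : ℤ) := by
  obtain ⟨d, hd⟩ := Int.eq_ofNat_of_zero_le (show 0 ≤ j' - j - 1 by omega)
  have : j' = j + d + 1 := by omega
  rw [this]; exact sum_H hh j d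

lemma survPlus_iff {A : Mat} {i : ℤ} {h : ℤ → ℤ} (hh : IsH A i h) (j : ℤ) :
    SurvPlus A i j ↔ ∀ j', j < j' → h j < h j' := by
  have key : ∀ j', j < j' → 0 < A i j → ((∑ t ∈ Finset.Ioc j j', A (i + 1) t) ≤
      (A i j - 1) + ∑ t ∈ Finset.Ioo j j', A i t ↔ h j < h j') := by
    intro j' hj hp
    have e := sum_H' hh hj
    rw [← Finset.Ioo_insert_left hj, Finset.sum_insert (by simp)] at e
    have e1 : (∑ t ∈ Finset.Ioc j j', (A (i + 1) t : ℤ))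
      = ((∑ t ∈ Finset.Ioc j j', A (i + 1) t : ℕ) : ℤ) := by push_cast; rfl
    have e2 : (∑ t ∈ Finset.Ioo j j', (A i t : ℤ))
      = ((∑ t ∈ Finset.Ioo j j', A i t : ℕ) : ℤ) := by push_cast; rfl
    rw [e1, e2] at e
    omega
  constructor
  · rintro ⟨h1, h2⟩ j' hj
    exact (key j' hj h1).1 (h2 j' hj)
  · intro H
    have hp : 0 < A i j := by
      have := H (j + 1) (by omega)
      have := hh j
      omega
    exact ⟨hp, fun j' hj => (key j' hj hp).2 (H j' hj)⟩

lemma survMinus_iff {A : Mat} {i : ℤ} {h : ℤ → ℤ} (hh : IsH A i h) (j : ℤ) :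
    SurvMinus A i j ↔ ∀ j', j' < j → h j < h j' := by
  have key : ∀ j', j' < j → 0 < A (i + 1) j → ((∑ t ∈ Finset.Ico j' j, A i t) ≤
      (A (i + 1) j - 1) + ∑ t ∈ Finset.Ioo j' j, A (i + 1) t ↔ h j < h j') := by
    intro j' hj hp
    have e := sum_H' hh hj
    rw [← Finset.Ioo_insert_right hj, Finset.sum_insert (by simp)] at e
    have e1 : (∑ t ∈ Finset.Ico j' j, (A i t : ℤ))
      = ((∑ t ∈ Finset.Ico j' j, A i t : ℕ) : ℤ) := by push_cast; rfl
    have e2 : (∑ t ∈ Finset.Ioo j' j, (A (i + 1) t : ℤ))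
      = ((∑ t ∈ Finset.Ioo j' j, A (i + 1) t : ℕ) : ℤ) := by push_cast; rfl
    rw [e1, e2] at e
    omega
  constructor
  · rintro ⟨h1, h2⟩ j' hj
    exact (key j' hj h1).1 (h2 j' hj)
  · intro H
    have hp : 0 < A (i + 1) j := by
      have := H (j - 1) (by omega)
      have := hh (j - 1)
      simp only [sub_add_cancel] at this
      omega
    exact ⟨hp, fun j' hj => (key j' hj hp).2 (H j' hj)⟩

lemma arg_plus {A : Mat} {i : ℤ} {h : ℤ → ℤ} (hh : IsH A i h) (j : ℤ) :
    (SurvPlus A i j ∧ ∀ j', SurvPlus A i j' → j ≤ j') ↔ ArgX true h j := by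
  simp only [survPlus_iff hh, ArgX, if_true]
  constructor
  · rintro ⟨h1, h2⟩
    have : ∀ s, h j ≤ h s := by
      by_contra hc
      push Not at hc
      obtain ⟨s, hs⟩ := hc
      obtain ⟨g, hg1, hg2⟩ := Int.exists_greatest_of_bdd (P := fun s => h s < h j)
        ⟨j, fun z hz => by by_contra hlt; exact absurd (h1 z (by omega)) (by omega)⟩ ⟨s, hs⟩
      have hgj : g < j := by
        rcases lt_trichotomy g j with h' | h' | h'
        · exact h'
        · subst h'; omega
        · have := h1 g h'; omega
      have := h2 g (fun j' hj' => by
        by_contra hlt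
        have := hg2 j' (by omega)
        omega)
      omega
    exact fun s => ⟨this s, h1 s⟩
  · intro H
    refine ⟨fun s => (H s).2, fun j' hj' => ?_⟩
    by_contra hlt
    have := hj' j (by omega)
    have := (H j').1
    omega

lemma arg_minus {A : Mat} {i : ℤ} {h : ℤ → ℤ} (hh : IsH A i h) (j : ℤ) :
    (SurvMinus A i j ∧ ∀ j', SurvMinus A i j' → j' ≤ j) ↔ ArgX false h j := by
  simp only [survMinus_iff hh, ArgX, Bool.false_eq_true, if_false]
  constructor
  · rintro ⟨h1, h2⟩
    have : ∀ s, h j ≤ h s := by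
      by_contra hc
      push Not at hc
      obtain ⟨s, hs⟩ := hc
      obtain ⟨g, hg1, hg2⟩ := Int.exists_least_of_bdd (P := fun s => h s < h j)
        ⟨j, fun z hz => by by_contra hlt; exact absurd (h1 z (by omega)) (by omega)⟩ ⟨s, hs⟩
      have hgj : j < g := by
        rcases lt_trichotomy g j with h' | h' | h'
        · have := h1 g h'; omega
        · subst h'; omega
        · exact h'
      have := h2 g (fun j' hj' => by
        by_contra hlt
        have := hg2 j' (by omega)
        omega)
      omega
    exact fun s => ⟨this s, h1 s⟩
  · intro H
    refine ⟨fun s => (H s).2, fun j' hj' => ?_⟩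
    by_contra hlt
    have := hj' j (by omega)
    have := (H j').1
    omega

lemma subAdd_entry {m n : ℕ} (hn : 0 < n) {A : Mat} (hA : PerM m n A) {i₁ i₂ t : ℤ}
    (h12 : i₁ ≠ i₂) (hp : 0 < A i₁ t) (r c : ℤ) :
    (subAddAt m n i₁ i₂ t A r c : ℤ) = A r c + (Orb m n i₂ t r c - Orb m n i₁ t r c) := by
  unfold subAddAt Orb
  by_cases h1 : ∃ k : ℤ, r = i₁ + k * m ∧ c = t + k * n
  · have h2 : ¬ ∃ k : ℤ, r = i₂ + k * m ∧ c = t + k * n := by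
      rintro ⟨k', e1, e2⟩
      obtain ⟨k, e3, e4⟩ := h1
      have : k * (n : ℤ) = k' * n := by linarith
      have : k = k' := mul_right_cancel₀ (by omega) this
      subst this
      omega
    simp only [if_pos h1, if_neg h2]
    obtain ⟨k, rfl, rfl⟩ := h1
    rw [hA.mul]
    omega
  · simp only [if_neg h1]
    split_ifs <;> simp

lemma Mv.unique {m n : ℕ} {x : Bool} {i t : ℤ} {A B C : Mat}
    (h1 : Mv m n x i t A B) (h2 : Mv m n x i t A C) : B = C := by
  funext r c
  exact_mod_cast (h1 r c).trans (h2 r c).symm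

lemma rowOp_arg {m n : ℕ} (hn : 0 < n) {A : Mat} (hA : PerM m n A) {x : Bool} {i : ℤ}
    {h : ℤ → ℤ} (hh : IsH A i h) {t : ℤ} (ht : ArgX x h t) :
    ∃ B, rowOp m n x i (some A) = some B ∧ Mv m n x i t A B := by
  cases x
  · have h1 := (arg_minus hh t).2 ht
    have hex : ∃ j : ℤ, SurvMinus A i j ∧ ∀ j' : ℤ, SurvMinus A i j' → j' ≤ j := ⟨t, h1⟩
    have hc : hex.choose = t := ((arg_minus hh _).1 hex.choose_spec).unique ht
    refine ⟨subAddAt m n (i + 1) i t A, ?_, ?_⟩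
    · simp only [rowOp, Option.bind_some, Bool.false_eq_true, if_false, eMat]
      rw [dif_pos hex, hc]
    · intro r c
      rw [subAdd_entry hn hA (by omega) h1.1.1]
      simp [epsX]
  · have h1 := (arg_plus hh t).2 ht
    have hex : ∃ j : ℤ, SurvPlus A i j ∧ ∀ j' : ℤ, SurvPlus A i j' → j ≤ j' := ⟨t, h1⟩
    have hc : hex.choose = t := ((arg_plus hh _).1 hex.choose_spec).unique ht
    refine ⟨subAddAt m n i (i + 1) t A, ?_, ?_⟩
    · simp only [rowOp, Option.bind_some, if_true, fMat]
      rw [dif_pos hex, hc]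
    · intro r c
      rw [subAdd_entry hn hA (by omega) h1.1.1]
      simp [epsX]

lemma rowOp_iff {m n : ℕ} (hn : 0 < n) {A : Mat} (hA : PerM m n A) {x : Bool} {i : ℤ}
    {h : ℤ → ℤ} (hh : IsH A i h) (B : Mat) :
    rowOp m n x i (some A) = some B ↔ ∃ t, ArgX x h t ∧ Mv m n x i t A B := by
  constructor
  · intro hB
    have hex : ∃ t, ArgX x h t := by
      cases x
      · simp only [rowOp, Option.bind_some, Bool.false_eq_true, if_false, eMat] at hB
        split_ifs at hB with h1
        exact ⟨_, (arg_minus hh _).1 h1.choose_spec⟩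
      · simp only [rowOp, Option.bind_some, if_true, fMat] at hB
        split_ifs at hB with h1
        exact ⟨_, (arg_plus hh _).1 h1.choose_spec⟩
    obtain ⟨t, ht⟩ := hex
    obtain ⟨B', h1, h2⟩ := rowOp_arg hn hA hh ht
    rw [h1] at hB
    cases hB
    exact ⟨t, ht, h2⟩
  · rintro ⟨t, ht, hM⟩
    obtain ⟨B', h1, h2⟩ := rowOp_arg hn hA hh ht
    rw [h1, hM.unique h2]

lemma colOp_iff_row (m n : ℕ) (A B : Mat) (y : Bool) (j : ℤ) :
    colOp m n y j (some A) = some B ↔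
      rowOp n m y j (some (transM A)) = some (transM B) := by
  have : ∀ o : Option Mat, o.map transM = some B ↔ o = some (transM B) := by
    intro o
    cases o with
    | none => simp
    | some C =>
      simp only [Option.map_some, Option.some.injEq]
      constructor
      · rintro rfl; rfl
      · rintro rfl; rfl
  cases y <;> simp [colOp, rowOp, fMatT, eMatT, this]

/-- The integer-function perturbation lemma. -/
lemma perturb (x y p : Bool) (k k' : ℤ → ℤ) (a : ℤ)
    (hk : if p then (if x then k (a + 1) ≤ k a else k (a + 1) < k a)
      else (if x then k a < k (a + 1) else k a ≤ k (a + 1)))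
    (hk' : ∀ s, k' s = k s + epsX x *
      (if p then (if s = a then 1 else 0) else (if s = a + 1 then -1 else 0))) :
    (∀ u, ArgX y k u →
      ((p = !y ∧ u = a + (if x then 0 else 1) ∧
          k (a + 1) - k a = (if x then if y then 1 else 0 else if y then 0 else -1)) →
        ArgX y k' (u + epsX x)) ∧
      (¬ (p = !y ∧ u = a + (if x then 0 else 1) ∧
          k (a + 1) - k a = (if x then if y then 1 else 0 else if y then 0 else -1)) →
        ArgX y k' u)) ∧
    (∀ v, ArgX y k' v → ∃ u, ArgX y k u) := by
  refine ⟨fun u hu => ⟨fun hs s => ?_, fun hs s => ?_⟩, fun v hv => ?_⟩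
  · have h1 := hu s
    have h2 := hu a
    have h3 := hu (a + 1)
    rw [hk' s, hk' (u + epsX x)]
    clear hk' hu
    cases x <;> cases y <;> cases p <;> simp [epsX] at * <;>
      obtain ⟨rfl, hs⟩ := hs <;> simp at * <;> split_ifs <;> (try subst s) <;> simp at * <;> omega
  · have h1 := hu s
    have h2 := hu a
    have h3 := hu (a + 1)
    rw [hk' s, hk' u]
    clear hk' hu
    cases x <;> cases y <;> cases p <;> simp [epsX] at * <;> 
      split_ifs <;> (try subst s) <;> (try subst u) <;> simp at * <;> omega
  · by_contra hc
    have g0 : ¬ ArgX y k v := fun h => hc ⟨_, h⟩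
    have g1 : ¬ ArgX y k a := fun h => hc ⟨_, h⟩
    have g2 : ¬ ArgX y k (a + 1) := fun h => hc ⟨_, h⟩
    simp only [ArgX, not_forall] at g0 g1 g2
    obtain ⟨s0, g0⟩ := g0
    obtain ⟨s1, g1⟩ := g1
    obtain ⟨s2, g2⟩ := g2
    have v0 := hv s0
    have v1 := hv s1
    have v2 := hv s2
    have v3 := hv a
    have v4 := hv (a + 1)
    simp only [hk'] at v0 v1 v2 v3 v4
    clear hk' hv hc
    cases x <;> cases y <;> cases p <;> simp [epsX] at * <;> grind

def Sp (m n : ℕ) (x y : Bool) (i j t u : ℤ) (A : Mat) : Prop :=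
  ∃ l : ℤ, t = j + l * n + (if y then 0 else 1) ∧ u = i - l * m + (if x then 0 else 1) ∧
    (A i (j + l * n) : ℤ) - A (i + 1) (j + l * n + 1) =
      (if x then if y then 1 else 0 else if y then 0 else -1)

lemma Sp.trans {m n : ℕ} {x y : Bool} {i j t u : ℤ} {A : Mat} (hA : PerM m n A)
    (h : Sp m n x y i j t u A) : Sp n m y x j i u t (transM A) := by
  obtain ⟨l, h1, h2, h3⟩ := h
  refine ⟨-l, by rw [h2]; ring, by rw [h1]; ring, ?_⟩
  have e1 := hA.mul (-l) i (j + l * n)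
  have e2 := hA.mul (-l) (i + 1) (j + l * n + 1)
  have q1 : j + l * n + -l * n = j := by ring
  have q2 : j + l * n + 1 + -l * n = j + 1 := by ring
  have q3 : i + 1 + -l * m = i + -l * m + 1 := by ring
  rw [q1] at e1
  rw [q2, q3] at e2
  simp only [transM]
  rw [e1, e2, h3]
  cases x <;> cases y <;> rfl

lemma shift_sub (n : ℕ) (hn : 2 ≤ n) (k : ℤ) (h : k * (n : ℤ) = 1) : False := by
  have : (n : ℤ) ∣ 1 := ⟨k, by linarith⟩
  have := Int.le_of_dvd (by norm_num) this
  omega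

lemma transfer {m n : ℕ} (hn : 2 ≤ n) {A B : Mat} (hA : PerM m n A)
    {x : Bool} (y : Bool) {i t : ℤ} (j : ℤ) (hM : Mv m n x i t A B) {h k : ℤ → ℤ}
    (hh : IsH A i h) (ht : ArgX x h t) (hk : IsH (transM A) j k) :
    ∃ k', IsH (transM B) j k' ∧
      (∀ u, ArgX y k u → (Sp m n x y i j t u A → ArgX y k' (u + epsX x)) ∧
        (¬ Sp m n x y i j t u A → ArgX y k' u)) ∧
      (∀ v, ArgX y k' v → ∃ u, ArgX y k u) := by
  have hnz : (n : ℤ) ≠ 0 := by omega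
  by_cases hc : ∃ (l : ℤ) (p : Bool), t = j + l * n + (if p then 1 else 0)
  · obtain ⟨l, p, hl⟩ := hc
    set a := i - l * m with ha
    let k' : ℤ → ℤ := fun s => k s + epsX x *
      (if p then (if s = a then 1 else 0) else (if s = a + 1 then -1 else 0))
    have hka : k (a + 1) - k a = (A i (j + l * n) : ℤ) - A (i + 1) (j + l * n + 1) := by
      rw [hk a]
      simp only [transM]
      rw [← hA.mul l a j, ← hA.mul l (a + 1) (j + 1)]
      have q1 : a + l * m = i := by rw [ha]; ring
      have q2 : a + 1 + l * m = i + 1 := by rw [ha]; ring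
      have q3 : j + 1 + l * n = j + l * n + 1 := by ring
      rw [q1, q2, q3]
    have hdiff : k (a + 1) - k a = h (j + l * n + 1) - h (j + l * n) := by rw [hka, hh]
    have hcond : if p then (if x then k (a + 1) ≤ k a else k (a + 1) < k a)
      else (if x then k a < k (a + 1) else k a ≤ k (a + 1)) := by
      have t1 := ht (j + l * n)
      have t2 := ht (j + l * n + 1)
      cases p <;> cases x <;> simp at * <;> subst t <;> simp at * <;> omega
    have hIs : IsH (transM B) j k' := by
      intro r
      have b1 := hM r j
      have b2 := hM (r + 1) (j + 1)
      have hkr := hk r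
      simp only [transM] at hkr ⊢
      have sh : ∀ b r c, Orb m n b t r c = Orb m n (b - l * m) (t - l * n) r c := by
        intro b r c
        rw [← Orb_shift m n l (b - l * m)]
        congr 1 <;> ring
      have s1 : i + 1 - l * m = a + 1 := by rw [ha]; ring
      rw [sh, sh, s1, ← ha] at b1 b2
      cases p
      · have s2 : t - l * n = j := by rw [hl]; simp
        rw [s2] at b1 b2
        rw [Orb_same _ _ (by omega), Orb_same _ _ (by omega)] at b1
        have nz : ∀ q : ℤ, j + 1 ≠ j + q * n := fun q hq => shift_sub n hn q (by linarith)
        rw [Orb_diff _ _ _ _ _ _ nz, Orb_diff _ _ _ _ _ _ nz] at b2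
        simp only [k']
        rw [b1, b2]
        cases x <;> simp [epsX] <;> split_ifs <;> omega
      · have s2 : t - l * n = j + 1 := by rw [hl]; simp; ring
        rw [s2] at b1 b2
        rw [Orb_same _ _ (by omega), Orb_same _ _ (by omega)] at b2
        have nz : ∀ q : ℤ, j ≠ j + 1 + q * n := fun q hq => shift_sub n hn (-q) (by linarith)
        rw [Orb_diff _ _ _ _ _ _ nz, Orb_diff _ _ _ _ _ _ nz] at b1
        simp only [k']
        rw [b1, b2]
        cases x <;> simp [epsX] <;> split_ifs <;> omega
    obtain ⟨P1, P2⟩ := perturb x y p k k' a hcond (fun s => rfl)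
    refine ⟨k', hIs, fun u hu => ?_, P2⟩
    have hiff : Sp m n x y i j t u A ↔ (p = !y ∧ u = a + (if x then 0 else 1) ∧
          k (a + 1) - k a = (if x then if y then 1 else 0 else if y then 0 else -1)) := by
      constructor
      · rintro ⟨l', e1, e2, e3⟩
        have e4 : (l - l') * (n : ℤ) = (if y then 0 else 1) - (if p then 1 else 0) := by
          linarith
        have hpy : p = !y := by
          cases p <;> cases y <;> simp at e4 ⊢
          · exact shift_sub n hn _ e4
          · exact shift_sub n hn (l' - l) (by linarith)
        have hll : l' = l := by
          subst hpy
          have : (l - l') * (n : ℤ) = 0 := by rw [e4]; cases y <;> simp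
          rcases mul_eq_zero.1 this with h' | h'
          · omega
          · exact absurd h' hnz
        subst hll
        exact ⟨hpy, e2, by rw [hka, e3]⟩
      · rintro ⟨e1, e2, e3⟩
        refine ⟨l, ?_, e2, by rw [← hka, e3]⟩
        rw [hl, e1]; cases y <;> simp
    rw [hiff]
    exact P1 u hu
  · push Not at hc
    have z0 : ∀ b r, Orb m n b t r j = 0 := fun b r =>
      Orb_diff _ _ _ _ _ _ (fun q hq => hc (-q) false (by simp; linarith))
    have z1 : ∀ b r, Orb m n b t r (j + 1) = 0 := fun b r =>
      Orb_diff _ _ _ _ _ _ (fun q hq => hc (-q) true (by simp; linarith))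
    refine ⟨k, fun r => ?_, fun u hu => ⟨?_, fun _ => hu⟩, fun v hv => ⟨v, hv⟩⟩
    · have b1 := hM r j
      have b2 := hM (r + 1) (j + 1)
      rw [z0, z0] at b1
      rw [z1, z1] at b2
      rw [hk r]
      simp only [transM]
      rw [b1, b2]; ring
    · rintro ⟨l, e1, -⟩
      exact absurd (by rw [e1]; cases y <;> simp) (hc l (!y))

lemma half {m n : ℕ} (hm : 2 ≤ m) (hn : 2 ≤ n) {A B D : Mat} (hA : PerM m n A)
    {x y : Bool} {i j : ℤ} (h1 : rowOp m n x i (some A) = some B)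
    (h2 : rowOp n m y j (some (transM B)) = some (transM D)) :
    ∃ C, rowOp n m y j (some (transM A)) = some (transM C) ∧
      rowOp m n x i (some C) = some D := by
  obtain ⟨h, hh⟩ := exists_IsH A i
  obtain ⟨k, hk⟩ := exists_IsH (transM A) j
  obtain ⟨t, ht, hM⟩ := (rowOp_iff (by omega) hA hh B).1 h1
  obtain ⟨k', hk', P1, P2⟩ := transfer hn hA y j hM hh ht hk
  have hB : PerM m n B := hM.per hA
  obtain ⟨v, hv, hMD⟩ := (rowOp_iff (by omega) hB.trans hk' _).1 h2
  obtain ⟨u, hu⟩ := P2 v hv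
  obtain ⟨C', hC', hMC⟩ := rowOp_arg (by omega) hA.trans hk hu
  have hAt : PerM n m (transM A) := hA.trans
  obtain ⟨h', hh', Q1, -⟩ := transfer hm hAt x i hMC hk hu (show IsH (transM (transM A)) i h from hh)
  refine ⟨transM C', hC', ?_⟩
  have hC : PerM m n (transM C') := (hMC.per hAt).trans
  rw [rowOp_iff (by omega) hC hh']
  by_cases hs : Sp m n x y i j t u A
  · have hu' := (P1 u hu).1 hs
    have hvu := hv.unique hu'
    refine ⟨_, (Q1 t ht).1 (hs.trans hA), fun r c => ?_⟩
    have d1 := hMD c r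
    have d2 := hM r c
    have d3 := hMC c r
    obtain ⟨l, e1, e2, -⟩ := hs
    have sh : ∀ q b, Orb m n (i - l * m + q) b r c = Orb m n (i + q) (b + l * n) r c := by
      intro q b
      rw [← Orb_shift m n l]
      congr 1; ring
    subst hvu
    simp only [transM] at d1 d3 ⊢
    rw [← Orb_trans m n, ← Orb_trans m n, e2, add_assoc, sh, sh] at d1
    rw [← Orb_trans m n, ← Orb_trans m n, e2, sh, sh] at d3
    rw [d1, d2, d3, e1]
    have s1 : j + 1 + l * n = j + l * n + 1 := by ring
    rw [s1]
    cases x <;> cases y <;> simp [epsX] <;> ring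
  · have hu' := (P1 u hu).2 hs
    have hvu := hv.unique hu'
    have hs' : ¬ Sp n m y x j i u t (transM A) := fun hc => hs (hc.trans hAt)
    refine ⟨_, (Q1 t ht).2 hs', fun r c => ?_⟩
    have d1 := hMD c r
    have d2 := hM r c
    have d3 := hMC c r
    subst hvu
    simp only [transM] at d1 d3 ⊢
    rw [d1, d2, d3]
    ring

/-- For `m, n ≥ 2`, every operator among `ẽ_i, f̃_i`
(`i ∈ {0, 1, …, m-1}`) commutes with every operator among `ẽ^t_j, f̃^t_j`
(`j ∈ {0, 1, …, n-1}`) as maps from `M̂_{m×n} ∪ {0}` to itself (each operator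
sends `0` to `0`). -/
theorem bicrystal_operators_commute (m n : ℕ) (hm : 2 ≤ m) (hn : 2 ≤ n)
    (x y : Bool) (i j : ℤ) (hi0 : 0 ≤ i) (hi1 : i ≤ (m : ℤ) - 1)
    (hj0 : 0 ≤ j) (hj1 : j ≤ (n : ℤ) - 1)
    (A : Mat) (hA : IsGAP m n A) :
    rowOp m n x i (colOp m n y j (some A)) =
      colOp m n y j (rowOp m n x i (some A)) := by
  have hP : PerM m n A := hA.1
  have L : ∀ D, rowOp m n x i (colOp m n y j (some A)) = some D ↔
      ∃ C, rowOp n m y j (some (transM A)) = some (transM C) ∧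
        rowOp m n x i (some C) = some D := by
    intro D
    conv_lhs => rw [rowOp, Option.bind_eq_some_iff]
    exact exists_congr fun C => and_congr (colOp_iff_row m n A C y j) Iff.rfl
  have R : ∀ D, colOp m n y j (rowOp m n x i (some A)) = some D ↔
      ∃ B, rowOp m n x i (some A) = some B ∧
        rowOp n m y j (some (transM B)) = some (transM D) := by
    intro D
    conv_lhs => rw [colOp, Option.bind_eq_some_iff]
    exact exists_congr fun C => and_congr Iff.rfl (colOp_iff_row m n C D y j)
  apply Option.ext
  intro D
  rw [L, R]
  constructor
  · rintro ⟨C, h1, h2⟩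
    obtain ⟨B, g1, g2⟩ := half (D := transM D) hn hm hP.trans h1 h2
    exact ⟨transM B, g1, g2⟩
  · rintro ⟨B, h1, h2⟩
    exact half hm hn hP h1 h2

end AffineRSK
end

section
/- For every nonzero A ∈ M̂_{m×n}, the set of channels of A is nonempty and finite, and it has a greatest element with respect to the partial order ≽_sw; this greatest channel is denoted C^{sw}_A and called the southwest channel of A. -/
open scoped Classical

namespace AffineRSK

def FD (n : ℕ) (S : Set Cell) : Set Cell := {c ∈ S | 0 ≤ c.2 ∧ c.2 < (n : ℤ)}

def TInv (m n : ℕ) (S : Set Cell) : Prop :=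
  ∀ (c : Cell) (k : ℤ), c ∈ S → ((c.1 + k * m, c.2 + k * n) : Cell) ∈ S

def Chn (S : Set Cell) : Prop := ∀ c ∈ S, ∀ d ∈ S, c = d ∨ NW c d ∨ NW d c

theorem tinv_of_step {m n : ℕ} {S : Set Cell}
    (h1 : ∀ c : Cell, c ∈ S → ((c.1 + m, c.2 + n) : Cell) ∈ S)
    (h2 : ∀ c : Cell, c ∈ S → ((c.1 - m, c.2 - n) : Cell) ∈ S) : TInv m n S := by
  intro c k hc
  induction k using Int.induction_on with
  | zero => simpa using hc
  | succ i ih =>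
    have := h1 _ ih
    convert this using 2 <;> push_cast <;> ring
  | pred i ih =>
    have := h2 _ ih
    convert this using 2 <;> push_cast <;> ring

theorem supp_tinv {m n : ℕ} {A : Mat} (hA : IsGAP m n A) : TInv m n (supp A) := by
  apply tinv_of_step
  · intro c hc
    simp only [supp, Set.mem_setOf_eq] at *
    rwa [hA.1]
  · intro c hc
    simp only [supp, Set.mem_setOf_eq] at *
    rw [← hA.1]
    simpa using hc

theorem supp_fd_finite {m n : ℕ} {A : Mat} (hA : IsGAP m n A) : (FD n (supp A)).Finite := by
  have : FD n (supp A) ⊆ ⋃ j ∈ Set.Ico (0 : ℤ) n, (fun i => ((i, j) : Cell)) '' {i : ℤ | A i j ≠ 0} := by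
    rintro ⟨i, j⟩ ⟨h, h1, h2⟩
    simp only [Set.mem_iUnion]
    exact ⟨j, ⟨h1, h2⟩, i, h, rfl⟩
  refine Set.Finite.subset ?_ this
  exact Set.Finite.biUnion (Set.finite_Ico _ _) fun j _ => (hA.2 j).image _

/-- every orbit meets the fundamental domain -/
theorem exists_fd {m n : ℕ} (hn : 0 < n) {S : Set Cell} (h : TInv m n S) {c : Cell} (hc : c ∈ S) :
    ((c.1 + (-(c.2 / n)) * m, c.2 + (-(c.2 / n)) * n) : Cell) ∈ FD n S := by
  refine ⟨h c _ hc, ?_, ?_⟩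
  · have := Int.emod_nonneg c.2 (b := (n : ℤ)) (by omega)
    have h2 := Int.emod_add_mul_ediv c.2 n
    simp only; nlinarith
  · have := Int.emod_lt_of_pos c.2 (b := (n : ℤ)) (by omega)
    have h2 := Int.emod_add_mul_ediv c.2 n
    simp only; nlinarith

theorem fd_inj {m n : ℕ} (hn : 0 < n) {S T : Set Cell} (hS : TInv m n S) (hT : TInv m n T)
    (h : FD n S ⊆ FD n T) : S ⊆ T := by
  intro c hc
  have := hT _ (c.2 / n) (h (exists_fd hn hS hc)).1
  simpa using this

theorem enum_shift {m n : ℕ} {e : ℤ → Cell} {l : ℕ} (h : IsStreamEnum m n e l) : TInv m n (Set.range e) := by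
  apply tinv_of_step
  · rintro _ ⟨i, rfl⟩
    exact ⟨i + l, (h.2.2 i).symm⟩
  · rintro _ ⟨i, rfl⟩
    refine ⟨i - l, ?_⟩
    have := h.2.2 (i - l)
    rw [sub_add_cancel] at this
    rw [← this]
    simp [tauC]

theorem enum_mono {m n : ℕ} {e : ℤ → Cell} {l : ℕ} (h : IsStreamEnum m n e l) :
    StrictMono (fun i => (e i).1) ∧ StrictMono (fun i => (e i).2) :=
  ⟨strictMono_int_of_lt_succ fun i => (h.2.1 i).1, strictMono_int_of_lt_succ fun i => (h.2.1 i).2⟩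

theorem enum_chn {m n : ℕ} {e : ℤ → Cell} {l : ℕ} (h : IsStreamEnum m n e l) : Chn (Set.range e) := by
  obtain ⟨h1, h2⟩ := enum_mono h
  rintro _ ⟨i, rfl⟩ _ ⟨j, rfl⟩
  rcases lt_trichotomy i j with hij | rfl | hij
  · exact Or.inr (Or.inl ⟨h1 hij, h2 hij⟩)
  · exact Or.inl rfl
  · exact Or.inr (Or.inr ⟨h1 hij, h2 hij⟩)

theorem enum_card {m n : ℕ} (hn : 0 < n) {e : ℤ → Cell} {l : ℕ} (h : IsStreamEnum m n e l) :
    (FD n (Set.range e)).ncard = l := by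
  obtain ⟨h1, h2⟩ := enum_mono h
  have hinj : Function.Injective e := fun i j hij => h2.injective (by simp [hij])
  have hsh : ∀ i, (e (i + l)).2 = (e i).2 + n := fun i => by rw [← h.2.2 i]; rfl
  obtain ⟨i1, hi1⟩ : ∃ i, 0 ≤ (e i).2 := by
    obtain ⟨i, hi⟩ := exists_fd hn (enum_shift h) ⟨0, rfl⟩ |>.1
    exact ⟨i, by rw [hi]; exact (exists_fd hn (enum_shift h) ⟨0, rfl⟩).2.1⟩
  obtain ⟨i2, hi2⟩ : ∃ i, (e i).2 < 0 := by
    obtain ⟨i, hi⟩ := exists_fd hn (enum_shift h) ⟨0, rfl⟩ |>.1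
    refine ⟨i - l, ?_⟩
    have a := (exists_fd hn (enum_shift h) ⟨0, rfl⟩).2.2
    rw [← hi] at a
    have b := hsh (i - l)
    rw [sub_add_cancel] at b
    omega
  obtain ⟨i0, p0, p1⟩ := Int.exists_least_of_bdd (P := fun i => 0 ≤ (e i).2)
    ⟨i2, fun z hz => by
      by_contra hlt
      have := h2 (not_le.mp hlt)
      simp only at this
      omega⟩ ⟨i1, hi1⟩
  have key : FD n (Set.range e) = ((Finset.Ico i0 (i0 + l)).image e : Finset Cell) := by
    ext c
    simp only [FD, Set.mem_setOf_eq, Finset.coe_image, Finset.coe_Ico, Set.mem_image, Set.mem_Ico]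
    constructor
    · rintro ⟨⟨i, rfl⟩, a, b⟩
      refine ⟨i, ⟨p1 i a, ?_⟩, rfl⟩
      by_contra hlt
      have := h2.monotone (not_lt.mp hlt)
      simp only [hsh] at this
      omega
    · rintro ⟨i, ⟨a, b⟩, rfl⟩
      refine ⟨⟨i, rfl⟩, ?_, ?_⟩
      · have : (e i0).2 ≤ (e i).2 := h2.monotone a
        omega
      · by_contra hlt
        have q := p1 (i - l) (by
          have b := hsh (i - l)
          rw [sub_add_cancel] at b
          omega)
        omega
  rw [key, Set.ncard_coe_finset, Finset.card_image_of_injective _ hinj]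
  simp

theorem chn_stream {m n : ℕ} (hn : 0 < n) {S : Set Cell} (hS : TInv m n S) (hc : Chn S)
    (hne : S.Nonempty) (hfin : (FD n S).Finite) : IsStream m n S (FD n S).ncard := by
  have hcol : ∀ c ∈ S, ∀ d ∈ S, c.2 = d.2 → c = d := by
    intro c h d h' he
    rcases hc c h d h' with h | h | h
    · exact h
    · exact absurd h.2 (by omega)
    · exact absurd h.2 (by omega)
  have hNW : ∀ c ∈ S, ∀ d ∈ S, c.2 < d.2 → NW c d := by
    intro c h d h' he
    rcases hc c h d h' with h | h | h
    · exact absurd he (by rw [h]; omega)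
    · exact h
    · exact absurd h.2 (by omega)
  set Y : Finset ℤ := hfin.toFinset.image Prod.snd with hY
  have hYc : Y.card = (FD n S).ncard := by
    rw [hY, Finset.card_image_of_injOn, Set.ncard_eq_toFinset_card _ hfin]
    intro c h d h' he
    simp only [Set.Finite.coe_toFinset] at h h'
    exact hcol c h.1 d h'.1 he
  set l := (FD n S).ncard with hl
  have hl0 : 0 < l := by
    obtain ⟨c, hcS⟩ := hne
    rw [hl, Set.ncard_pos hfin]
    exact ⟨_, exists_fd hn hS hcS⟩
  have hmem : ∀ y ∈ Y, ∃ c ∈ S, c.2 = y ∧ 0 ≤ y ∧ y < n := by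
    intro y hy
    simp only [hY, Finset.mem_image, Set.Finite.mem_toFinset] at hy
    obtain ⟨c, hc, rfl⟩ := hy
    exact ⟨c, hc.1, rfl, hc.2⟩
  let f := Y.orderEmbOfFin hYc
  have hfY : ∀ k, f k ∈ Y := fun k => Finset.orderEmbOfFin_mem _ _ _
  have hr0 : ∀ i : ℤ, 0 ≤ i % l := fun i => Int.emod_nonneg _ (by omega)
  have hr1 : ∀ i : ℤ, i % l < l := fun i => Int.emod_lt_of_pos _ (by omega)
  let r : ℤ → Fin l := fun i => ⟨(i % l).toNat, by have := hr0 i; have := hr1 i; omega⟩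
  let y : ℤ → ℤ := fun i => f (r i) + (i / l) * n
  have hyS : ∀ i, ∃ c ∈ S, c.2 = y i := by
    intro i
    obtain ⟨c, h, h1, h2, h3⟩ := hmem _ (hfY (r i))
    exact ⟨_, hS c (i / l) h, by simp [h1, y]⟩
  choose e heS hey using hyS
  have hmono : ∀ i, y i < y (i + 1) := by
    intro i
    have a0 := hr0 i
    have a1 := hr1 i
    have b := Int.emod_add_mul_ediv i l
    by_cases hlt : i % l + 1 < l
    · have q : (i + 1) / l = i / l ∧ (i + 1) % l = i % l + 1 := by
        rw [Int.ediv_emod_unique (by omega)]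
        refine ⟨by linarith, by omega, by omega⟩
      simp only [y, q.1]
      have : r i < r (i + 1) := by
        rw [Fin.lt_def]; simp only [r, q.2]; omega
      have := f.strictMono this
      omega
    · have q : (i + 1) / l = i / l + 1 ∧ (i + 1) % l = 0 := by
        rw [Int.ediv_emod_unique (by omega)]
        refine ⟨by linarith, by omega, by omega⟩
      simp only [y, q.1]
      obtain ⟨_, _, _, h2, h3⟩ := hmem _ (hfY (r i))
      obtain ⟨_, _, _, h4, h5⟩ := hmem _ (hfY (r (i + 1)))
      linarith
  refine ⟨e, ⟨hl0, fun i => hNW _ (heS _) _ (heS _) (by rw [hey, hey]; exact hmono i), ?_⟩, ?_⟩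
  · intro i
    have t : tauC m n (e i) ∈ S := by simpa [tauC] using hS _ 1 (heS i)
    refine hcol _ t _ (heS _) ?_
    have q : (i + l) / l = i / l + 1 := by
      rw [Int.add_ediv_of_dvd_right (dvd_refl _), Int.ediv_self (by omega)]
    have q2 : r (i + l) = r i := by simp [r]
    simp only [tauC, hey, y, q, q2]
    ring
  · apply Set.Subset.antisymm
    · rintro _ ⟨i, rfl⟩
      exact heS i
    · intro c hcS
      have h := exists_fd hn hS hcS
      have hy : c.2 + (-(c.2 / n)) * n ∈ Y := by
        simp only [hY, Finset.mem_image, Set.Finite.mem_toFinset]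
        exact ⟨_, h, rfl⟩
      have : c.2 + (-(c.2 / n)) * n ∈ Set.range f := by
        rw [Finset.range_orderEmbOfFin]; exact hy
      obtain ⟨k, hk⟩ := this
      refine ⟨k + l * (c.2 / n), hcol _ (heS _) _ hcS ?_⟩
      have q : ((k : ℤ) + l * (c.2 / n)) / l = c.2 / n ∧ ((k : ℤ) + l * (c.2 / n)) % l = k := by
        rw [Int.ediv_emod_unique (by omega)]
        have := k.2
        refine ⟨by ring, by omega, by omega⟩
      have q2 : r ((k : ℤ) + l * (c.2 / n)) = k := by
        ext; simp only [r, q.2]; simp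
      rw [hey]
      simp only [y, q2, hk, q.1]
      ring

theorem neLe_trans {a b c : Cell} (h : neLe a b) (h' : neLe b c) : neLe a c :=
  ⟨h'.1.trans h.1, h.2.trans h'.2⟩

theorem chn_neLe {S : Set Cell} (hS : Chn S) {a b : Cell} (ha : a ∈ S) (hb : b ∈ S)
    (h : neLe a b) : a = b := by
  rcases hS a ha b hb with h1 | h1 | h1
  · exact h1
  · exact absurd h1.1 (by have := h.1; omega)
  · exact absurd h1.2 (by have := h.2; omega)

theorem neLe_antisymm {a b : Cell} (h : neLe a b) (h' : neLe b a) : a = b :=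
  Prod.ext (le_antisymm h'.1 h.1) (le_antisymm h.2 h'.2)

theorem comp_or (a b : Cell) : NW a b ∨ NW b a ∨ neLe a b ∨ neLe b a := by
  unfold NW neLe; omega

def lowS (C D : Set Cell) : Set Cell :=
  {c | (c ∈ C ∧ ∃ d ∈ D, neLe c d) ∨ (c ∈ D ∧ ∃ d ∈ C, neLe c d)}

def uppS (C D : Set Cell) : Set Cell :=
  {c | (c ∈ C ∧ ∃ d ∈ D, neLe d c) ∨ (c ∈ D ∧ ∃ d ∈ C, neLe d c)}

theorem neLe_shift {m n : ℕ} {a b : Cell} (k : ℤ) (h : neLe a b) :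
    neLe (a.1 + k * m, a.2 + k * n) (b.1 + k * m, b.2 + k * n) := by
  have h1 := h.1
  have h2 := h.2
  constructor <;> simp only <;> omega

theorem lowS_tinv {m n : ℕ} {C D : Set Cell} (hC : TInv m n C) (hD : TInv m n D) :
    TInv m n (lowS C D) := by
  rintro c k (⟨h, d, hd, h'⟩ | ⟨h, d, hd, h'⟩)
  · exact Or.inl ⟨hC c k h, _, hD d k hd, neLe_shift k h'⟩
  · exact Or.inr ⟨hD c k h, _, hC d k hd, neLe_shift k h'⟩

theorem uppS_tinv {m n : ℕ} {C D : Set Cell} (hC : TInv m n C) (hD : TInv m n D) :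
    TInv m n (uppS C D) := by
  rintro c k (⟨h, d, hd, h'⟩ | ⟨h, d, hd, h'⟩)
  · exact Or.inl ⟨hC c k h, _, hD d k hd, neLe_shift k h'⟩
  · exact Or.inr ⟨hD c k h, _, hC d k hd, neLe_shift k h'⟩

theorem lowS_aux {C D : Set Cell} (hC : Chn C) (hD : Chn D) {a b a' b' : Cell}
    (ha : a ∈ C) (hb : b ∈ D) (hb' : b' ∈ D) (h1 : neLe a b') (ha' : a' ∈ C) (h2 : neLe b a') :
    a = b ∨ NW a b ∨ NW b a := by
  rcases comp_or a b with h | h | h | h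
  · exact Or.inr (Or.inl h)
  · exact Or.inr (Or.inr h)
  · left
    have := chn_neLe hC ha ha' (neLe_trans h h2)
    subst this
    exact neLe_antisymm h h2
  · left
    have := chn_neLe hD hb hb' (neLe_trans h h1)
    subst this
    exact neLe_antisymm h1 h

theorem uppS_aux {C D : Set Cell} (hC : Chn C) (hD : Chn D) {a b a' b' : Cell}
    (ha : a ∈ C) (hb : b ∈ D) (hb' : b' ∈ D) (h1 : neLe b' a) (ha' : a' ∈ C) (h2 : neLe a' b) :
    a = b ∨ NW a b ∨ NW b a := by
  rcases comp_or a b with h | h | h | h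
  · exact Or.inr (Or.inl h)
  · exact Or.inr (Or.inr h)
  · left
    have := chn_neLe hD hb' hb (neLe_trans h1 h)
    subst this
    exact neLe_antisymm h h1
  · left
    have := chn_neLe hC ha' ha (neLe_trans h2 h)
    subst this
    exact neLe_antisymm h2 h

theorem lowS_chn {C D : Set Cell} (hC : Chn C) (hD : Chn D) : Chn (lowS C D) := by
  rintro a (⟨ha, b', hb', h1⟩ | ⟨ha, b', hb', h1⟩) b (⟨hb, a', ha', h2⟩ | ⟨hb, a', ha', h2⟩)
  · exact hC a ha b hb
  · exact lowS_aux hC hD ha hb hb' h1 ha' h2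
  · exact lowS_aux hD hC ha hb hb' h1 ha' h2
  · exact hD a ha b hb

theorem uppS_chn {C D : Set Cell} (hC : Chn C) (hD : Chn D) : Chn (uppS C D) := by
  rintro a (⟨ha, b', hb', h1⟩ | ⟨ha, b', hb', h1⟩) b (⟨hb, a', ha', h2⟩ | ⟨hb, a', ha', h2⟩)
  · exact hC a ha b hb
  · exact uppS_aux hC hD ha hb hb' h1 ha' h2
  · exact uppS_aux hD hC ha hb hb' h1 ha' h2
  · exact hD a ha b hb

theorem fd_mono {n : ℕ} {S T : Set Cell} (h : S ⊆ T) : FD n S ⊆ FD n T := fun _ hc => ⟨h hc.1, hc.2⟩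

/-- Combinatorial characterization of channels. -/
structure Good (m n : ℕ) (A : Mat) (C : Set Cell) : Prop where
  sub : C ⊆ supp A
  inv : TInv m n C
  chn : Chn C
  ne : C.Nonempty
  max : ∀ S : Set Cell, S ⊆ supp A → TInv m n S → Chn S → (FD n S).ncard ≤ (FD n C).ncard

theorem channel_good {m n : ℕ} (hn : 0 < n) {A : Mat} (hA : IsGAP m n A) {C : Set Cell} :
    IsChannel m n A C ↔ Good m n A C := by
  constructor
  · rintro ⟨l, ⟨e, he, rfl⟩, hs, hmax⟩
    refine ⟨hs, enum_shift he, enum_chn he, ⟨_, 0, rfl⟩, ?_⟩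
    intro S hS hi hc
    rw [enum_card hn he]
    rcases S.eq_empty_or_nonempty with rfl | hne
    · simp [FD]
    · exact hmax S _ (chn_stream hn hi hc hne ((supp_fd_finite hA).subset (fd_mono hS))) hS
  · rintro ⟨hs, hi, hc, hne, hmax⟩
    refine ⟨_, chn_stream hn hi hc hne ((supp_fd_finite hA).subset (fd_mono hs)), hs, ?_⟩
    rintro S l' ⟨e, he, rfl⟩ hS
    have := hmax _ hS (enum_shift he) (enum_chn he)
    rwa [enum_card hn he] at this

theorem good_comp {m n : ℕ} (hm : 0 < m) (hn : 0 < n) {A : Mat} (hA : IsGAP m n A) {C : Set Cell}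
    (hC : Good m n A C) {c : Cell} (hc : c ∈ supp A) :
    ∃ d ∈ C, neLe c d ∨ neLe d c := by
  by_contra hcon
  push Not at hcon
  have hmZ : (0 : ℤ) < m := by exact_mod_cast hm
  have hnZ : (0 : ℤ) < n := by exact_mod_cast hn
  let O : Set Cell := Set.range fun k : ℤ => ((c.1 + k * m, c.2 + k * n) : Cell)
  have hO : TInv m n O := by
    rintro _ k ⟨j, rfl⟩
    exact ⟨j + k, by simp only; ext <;> ring⟩
  have hcO : c ∈ O := ⟨0, by simp⟩
  have hOs : O ⊆ supp A := by
    rintro _ ⟨j, rfl⟩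
    exact supp_tinv hA c j hc
  have hlt : ∀ j k : ℤ, j < k → NW ((c.1 + j * m, c.2 + j * n) : Cell) (c.1 + k * m, c.2 + k * n) := by
    intro j k h
    constructor <;> simp only <;> nlinarith
  have hOD : ∀ a ∈ O, ∀ d ∈ C, NW a d ∨ NW d a := by
    rintro _ ⟨j, rfl⟩ d hd
    have := hcon _ (hC.inv d (-j) hd)
    rcases comp_or (c.1 + j * m, c.2 + j * n) d with h | h | h | h
    · exact Or.inl h
    · exact Or.inr h
    · refine absurd ?_ this.1
      have := neLe_shift (m := m) (n := n) (-j) h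
      simpa using this
    · refine absurd ?_ this.2
      have := neLe_shift (m := m) (n := n) (-j) h
      simpa using this
  have hmax := hC.max (C ∪ O) (Set.union_subset hC.sub hOs)
    (by
      rintro a k (h | h)
      · exact Or.inl (hC.inv a k h)
      · exact Or.inr (hO a k h))
    (by
      rintro a (h | h) b (h' | h')
      · exact hC.chn a h b h'
      · exact Or.inr ((hOD b h' a h).symm)
      · exact Or.inr (hOD a h b h')
      · obtain ⟨j, rfl⟩ := h
        obtain ⟨k, rfl⟩ := h'
        rcases lt_trichotomy j k with h | rfl | h
        · exact Or.inr (Or.inl (hlt _ _ h))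
        · exact Or.inl rfl
        · exact Or.inr (Or.inr (hlt _ _ h)))
  have hfin : (FD n (C ∪ O)).Finite :=
    (supp_fd_finite hA).subset (fd_mono (Set.union_subset hC.sub hOs))
  have heq := Set.eq_of_subset_of_ncard_le (fd_mono Set.subset_union_left) hmax hfin
  have hx := fd_mono (n := n) (Set.subset_union_right (s := C)) (exists_fd hn hO hcO)
  rw [← heq] at hx
  have := hC.inv _ (c.2 / n) hx.1
  have hcC : c ∈ C := by simpa using this
  exact (hcon c hcC).1 ⟨le_rfl, le_rfl⟩

theorem good_low {m n : ℕ} (hm : 0 < m) (hn : 0 < n) {A : Mat} (hA : IsGAP m n A) {C D : Set Cell}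
    (hC : Good m n A C) (hD : Good m n A D) : Good m n A (lowS C D) := by
  have hls : lowS C D ⊆ supp A := by
    rintro c (h | h)
    · exact hC.sub h.1
    · exact hD.sub h.1
  have hus : uppS C D ⊆ supp A := by
    rintro c (h | h)
    · exact hC.sub h.1
    · exact hD.sub h.1
  have fin : ∀ S ⊆ supp A, (FD n S).Finite := fun S hS => (supp_fd_finite hA).subset (fd_mono hS)
  have e1 := Set.ncard_union_add_ncard_inter (FD n (lowS C D)) (FD n (uppS C D)) (fin _ hls) (fin _ hus)
  have e2 := Set.ncard_union_add_ncard_inter (FD n C) (FD n D) (fin _ hC.sub) (fin _ hD.sub)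
  have s1 : FD n C ∪ FD n D ⊆ FD n (lowS C D) ∪ FD n (uppS C D) := by
    rintro c (⟨h, h'⟩ | ⟨h, h'⟩)
    · obtain ⟨d, hd, q | q⟩ := good_comp hm hn hA hD (hC.sub h)
      · exact Or.inl ⟨Or.inl ⟨h, d, hd, q⟩, h'⟩
      · exact Or.inr ⟨Or.inl ⟨h, d, hd, q⟩, h'⟩
    · obtain ⟨d, hd, q | q⟩ := good_comp hm hn hA hC (hD.sub h)
      · exact Or.inl ⟨Or.inr ⟨h, d, hd, q⟩, h'⟩
      · exact Or.inr ⟨Or.inr ⟨h, d, hd, q⟩, h'⟩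
  have s2 : FD n C ∩ FD n D ⊆ FD n (lowS C D) ∩ FD n (uppS C D) := by
    rintro c ⟨⟨h, h'⟩, ⟨h2, _⟩⟩
    exact ⟨⟨Or.inl ⟨h, c, h2, le_rfl, le_rfl⟩, h'⟩, ⟨Or.inl ⟨h, c, h2, le_rfl, le_rfl⟩, h'⟩⟩
  have c1 := Set.ncard_le_ncard s1 ((fin _ hls).union (fin _ hus))
  have c2 := Set.ncard_le_ncard s2 ((fin _ hls).inter_of_left _)
  have u := hC.max _ hus (uppS_tinv hC.inv hD.inv) (uppS_chn hC.chn hD.chn)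
  have cd := hD.max C hC.sub hC.inv hC.chn
  have hge : (FD n C).ncard ≤ (FD n (lowS C D)).ncard := by omega
  refine ⟨hls, lowS_tinv hC.inv hD.inv, lowS_chn hC.chn hD.chn, ?_, fun S h1 h2 h3 => (hC.max S h1 h2 h3).trans hge⟩
  have hpos : 0 < (FD n C).ncard := by
    obtain ⟨c, hc⟩ := hC.ne
    rw [Set.ncard_pos (fin _ hC.sub)]
    exact ⟨_, exists_fd hn hC.inv hc⟩
  have hne : (FD n (lowS C D)).Nonempty := by
    rw [← Set.ncard_pos (fin _ hls)]; omega
  obtain ⟨c, hc⟩ := hne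
  exact ⟨c, hc.1⟩

theorem good_nonempty {m n : ℕ} (hm : 0 < m) (hn : 0 < n) {A : Mat} (hA : IsGAP m n A) (hA0 : A ≠ 0) :
    ∃ C, Good m n A C := by
  obtain ⟨c, hc⟩ : ∃ c, c ∈ supp A := by
    by_contra hcon
    push Not at hcon
    apply hA0
    funext i j
    have := hcon (i, j)
    simpa [supp] using this
  let P : ℕ → Prop := fun k => ∃ S : Set Cell, S ⊆ supp A ∧ TInv m n S ∧ Chn S ∧ S.Nonempty ∧ (FD n S).ncard = k
  have hmZ : (0 : ℤ) < m := by exact_mod_cast hm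
  have hnZ : (0 : ℤ) < n := by exact_mod_cast hn
  have hP : ∃ k, P k := by
    refine ⟨_, Set.range fun k : ℤ => ((c.1 + k * m, c.2 + k * n) : Cell), ?_, ?_, ?_, ⟨_, 0, rfl⟩, rfl⟩
    · rintro _ ⟨j, rfl⟩
      exact supp_tinv hA c j hc
    · rintro _ k ⟨j, rfl⟩
      exact ⟨j + k, by simp only; ext <;> ring⟩
    · rintro _ ⟨j, rfl⟩ _ ⟨k, rfl⟩
      rcases lt_trichotomy j k with h | rfl | h
      · right; left; constructor <;> simp only <;> nlinarith
      · exact Or.inl rfl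
      · right; right; constructor <;> simp only <;> nlinarith
  have hb : ∀ k, P k → k ≤ (FD n (supp A)).ncard := by
    rintro k ⟨S, hS, _, _, _, rfl⟩
    exact Set.ncard_le_ncard (fd_mono hS) (supp_fd_finite hA)
  obtain ⟨k, hk⟩ := hP
  have hs := Nat.findGreatest_spec (P := P) (hb k hk) hk
  obtain ⟨S, h1, h2, h3, h4, h5⟩ := hs
  refine ⟨S, h1, h2, h3, h4, fun T t1 t2 t3 => ?_⟩
  rcases T.eq_empty_or_nonempty with rfl | hne
  · simp [FD]
  · rw [h5]
    have hT : P (FD n T).ncard := ⟨T, t1, t2, t3, hne, rfl⟩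
    exact Nat.le_findGreatest (hb _ hT) hT

theorem good_finite {m n : ℕ} (hn : 0 < n) {A : Mat} (hA : IsGAP m n A) :
    {C | Good m n A C}.Finite := by
  refine Set.Finite.of_finite_image (f := FD n) ((supp_fd_finite hA).finite_subsets.subset ?_) ?_
  · rintro _ ⟨C, hC, rfl⟩
    exact fd_mono hC.sub
  · intro C hC D hD h
    exact Set.Subset.antisymm (fd_inj hn hC.inv hD.inv h.le) (fd_inj hn hD.inv hC.inv h.ge)

theorem swGe_trans {A : Mat} {C D E : Set Cell} (h : swGe A C D) (h' : swGe A D E) : swGe A C E := by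
  intro c hc
  obtain ⟨h1, d, hd, h2⟩ := h hc
  obtain ⟨_, x, hx, h3⟩ := h' hd
  exact ⟨h1, x, hx, neLe_trans h2 h3⟩

theorem good_greatest {m n : ℕ} (hm : 0 < m) (hn : 0 < n) {A : Mat} (hA : IsGAP m n A) (hA0 : A ≠ 0) :
    ∃ C, Good m n A C ∧ ∀ D, Good m n A D → swGe A C D := by
  have key : ∀ T : Set (Set Cell), T.Finite → (∀ D ∈ T, Good m n A D) →
      ∃ C, Good m n A C ∧ ∀ D ∈ T, swGe A C D := by
    intro T hT
    induction T, hT using Set.Finite.induction_on with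
    | empty =>
      intro _
      obtain ⟨C, hC⟩ := good_nonempty hm hn hA hA0
      exact ⟨C, hC, by simp⟩
    | insert _ _ ih =>
      rename_i a s _ _
      intro h
      obtain ⟨C, hC, hCs⟩ := ih fun D hD => h D (Set.mem_insert_of_mem _ hD)
      have ha := h a (Set.mem_insert _ _)
      have hg := good_low hm hn hA hC ha
      refine ⟨_, hg, ?_⟩
      intro D hD
      rcases Set.mem_insert_iff.mp hD with rfl | hD
      · intro c hc
        refine ⟨hg.sub hc, ?_⟩
        rcases hc with ⟨_, h⟩ | ⟨h, _⟩
        · exact h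
        · exact ⟨c, h, le_rfl, le_rfl⟩
      · refine swGe_trans ?_ (hCs D hD)
        intro c hc
        refine ⟨hg.sub hc, ?_⟩
        rcases hc with ⟨h, _⟩ | ⟨_, h⟩
        · exact ⟨c, h, le_rfl, le_rfl⟩
        · exact h
  obtain ⟨C, h1, h2⟩ := key _ (good_finite hn hA) fun D hD => hD
  exact ⟨C, h1, fun D hD => h2 D hD⟩

/-- For every nonzero `A ∈ M̂_{m×n}`, the set of channels of
`A` is nonempty and finite, and it has a greatest element with respect to the
partial order `≽_sw` (the southwest channel `C^{sw}_A`). -/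
theorem southwest_channel_exists (m n : ℕ) (hm : 0 < m) (hn : 0 < n)
    (A : Mat) (hA : IsGAP m n A) (hA0 : A ≠ 0) :
    {C : Set Cell | IsChannel m n A C}.Nonempty ∧
    {C : Set Cell | IsChannel m n A C}.Finite ∧
    ∃ C : Set Cell, IsChannel m n A C ∧
      ∀ C' : Set Cell, IsChannel m n A C' → swGe A C C' := by
  have hset : {C : Set Cell | IsChannel m n A C} = {C | Good m n A C} := by
    ext C
    exact channel_good hn hA
  refine ⟨?_, ?_, ?_⟩
  · rw [hset]
    exact good_nonempty hm hn hA hA0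
  · rw [hset]
    exact good_finite hn hA
  · obtain ⟨C, h1, h2⟩ := good_greatest hm hn hA hA0
    exact ⟨C, (channel_good hn hA).mpr h1, fun D hD => h2 D ((channel_good hn hA).mp hD)⟩

end AffineRSK
end

section
/- For every nonzero A ∈ M̂_{m×n} and every channel C of A, the channel numbering d^C_A is well defined (the supremum defining d^C_A(c) is finite for every c ∈ supp(A)) and is a proper numbering on A; moreover d^C_A(c) = d₀(c) for every c ∈ C. -/
open scoped Classical

namespace AffineRSK

def tz (m n : ℕ) (a : ℤ) (c : Cell) : Cell := (c.1 + a * m, c.2 + a * n)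

def Reach (S : Set Cell) : ℕ → Cell → Cell → Prop
  | 0, x, y => x = y ∧ x ∈ S
  | (k+1), x, y => ∃ z, Reach S k x z ∧ NW z y ∧ y ∈ S

lemma NW.tr {a b c : Cell} (h : NW a b) (h' : NW b c) : NW a c :=
  ⟨h.1.trans h'.1, h.2.trans h'.2⟩

lemma Reach.tr {S : Set Cell} {k : ℕ} {x y : Cell} (h : Reach S k x y) :
    ∀ (j : ℕ) (z : Cell), Reach S j y z → Reach S (k + j) x z
  | 0, z, hz => by
    obtain ⟨rfl, _⟩ := hz
    exact h
  | (j+1), z, hz => by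
    obtain ⟨w, h1, h2⟩ := hz
    exact ⟨w, Reach.tr h j w h1, h2⟩

lemma Reach.mem {S : Set Cell} {k : ℕ} {x y : Cell} (h : Reach S k x y) : y ∈ S := by
  cases k with
  | zero => obtain ⟨rfl, h⟩ := h; exact h
  | succ k => obtain ⟨_, _, _, h⟩ := h; exact h

lemma Reach.fn {S : Set Cell} {k : ℕ} {x y : Cell} (h : Reach S k x y) :
    ∃ f : ℕ → Cell, f 0 = x ∧ f k = y ∧ (∀ i ≤ k, f i ∈ S) ∧ ∀ i < k, NW (f i) (f (i+1)) := by
  induction k generalizing y with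
  | zero =>
    obtain ⟨rfl, h⟩ := h
    exact ⟨fun _ => x, rfl, rfl, fun _ _ => h, fun i hi => by omega⟩
  | succ k ih =>
    obtain ⟨z, h1, h2, h3⟩ := h
    obtain ⟨f, f0, fk, fS, fN⟩ := ih h1
    refine ⟨fun i => if i ≤ k then f i else y, by simpa using f0, by simp, ?_, ?_⟩
    · intro i hi
      by_cases hk : i ≤ k
      · simpa [hk] using fS i hk
      · simpa [hk] using h3
    · intro i hi
      by_cases hk : i + 1 ≤ k
      · have : i ≤ k := by omega
        simpa [hk, this] using fN i (by omega)
      · have : i = k := by omega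
        subst this
        simpa [fk] using h2

lemma reach_seq {S : Set Cell} (c : ℤ → Cell) (hS : ∀ i, c i ∈ S)
    (hN : ∀ i, NW (c i) (c (i+1))) (i : ℤ) (k : ℕ) : Reach S k (c i) (c (i + k)) := by
  induction k with
  | zero => exact ⟨by simp, hS i⟩
  | succ k ih =>
    refine ⟨_, ih, ?_, hS _⟩
    have := hN (i + k)
    push_cast
    rwa [← add_assoc]

lemma seq_mono (c : ℤ → Cell) (hN : ∀ i, NW (c i) (c (i+1))) (i : ℤ) (k : ℕ) :
    (c i).1 + k ≤ (c (i + k)).1 ∧ (c i).2 + k ≤ (c (i + k)).2 := by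
  induction k with
  | zero => simp
  | succ k ih =>
    have h1 := hN (i + k)
    obtain ⟨h1, h2⟩ := h1
    rw [show i + ((k + 1 : ℕ) : ℤ) = i + k + 1 by push_cast; ring]
    push_cast
    omega

lemma seq_lt (c : ℤ → Cell) (hN : ∀ i, NW (c i) (c (i+1))) {i j : ℤ} (h : i < j) :
    NW (c i) (c j) := by
  have := seq_mono c hN i (j - i).toNat
  rw [show i + ((j - i).toNat : ℤ) = j by omega] at this
  constructor <;> omega

lemma seq_lt_iff (c : ℤ → Cell) (hN : ∀ i, NW (c i) (c (i+1))) {i j : ℤ} :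
    NW (c i) (c j) ↔ i < j := by
  refine ⟨fun h => ?_, seq_lt c hN⟩
  by_contra hh
  rcases (not_lt.1 hh).eq_or_lt with rfl | h'
  · exact absurd h.1 (lt_irrefl _)
  · exact absurd (h.1.trans (seq_lt c hN h').1) (lt_irrefl _)

lemma seq_inj (c : ℤ → Cell) (hN : ∀ i, NW (c i) (c (i+1))) {i j : ℤ} (h : c i = c j) :
    i = j := by
  rcases lt_trichotomy i j with h' | h' | h'
  · have := (seq_lt c hN h').1; rw [h] at this; omega
  · exact h'
  · have := (seq_lt c hN h').1; rw [h] at this; omega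

lemma exists_closed {m n : ℕ} {S : Set Cell} (hS : ∀ a c, c ∈ S → tz m n a c ∈ S)
    {p : ℕ} (hp : 0 < p) {a : ℤ} {x : Cell} (h : Reach S p x (tz m n a x)) :
    ∃ c : ℤ → Cell, (∀ i, c i ∈ S) ∧ (∀ i, NW (c i) (c (i+1))) ∧
      ∀ i, c (i + p) = tz m n a (c i) := by
  obtain ⟨f, f0, fp, fS, fN⟩ := h.fn
  have hp' : (0:ℤ) < p := by exact_mod_cast hp
  refine ⟨fun i => tz m n (a * (i / p)) (f (i % p).toNat), ?_, ?_, ?_⟩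
  · intro i
    apply hS
    apply fS
    have := Int.emod_lt_of_pos i hp'
    omega
  · intro i
    have h1 := Int.emod_lt_of_pos i hp'
    have h0 := Int.emod_nonneg i hp'.ne'
    have hd := Int.emod_add_mul_ediv i p
    by_cases hr : i % p + 1 < p
    · have e1 : (i+1) / (p:ℤ) = i / p ∧ (i+1) % (p:ℤ) = i % p + 1 :=
        (Int.ediv_emod_unique hp').2 ⟨by linarith, by omega, hr⟩
      simp only [e1.1, e1.2]
      have := fN (i % p).toNat (by omega)
      rw [show (i % (p:ℤ) + 1).toNat = (i % (p:ℤ)).toNat + 1 by omega]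
      exact ⟨by simpa [tz] using this.1, by simpa [tz] using this.2⟩
    · have e1 : (i+1) / (p:ℤ) = i / p + 1 ∧ (i+1) % (p:ℤ) = 0 :=
        (Int.ediv_emod_unique hp').2 ⟨by rw [mul_add]; linarith, le_refl _, hp'⟩
      simp only [e1.1, e1.2]
      have := fN (i % p).toNat (by omega)
      rw [show (i % (p:ℤ)).toNat + 1 = p by omega, fp] at this
      obtain ⟨t1, t2⟩ := this
      simp only [tz, NW, Int.toNat_zero, f0] at t1 t2 ⊢
      constructor <;> nlinarith
  · intro i
    have e1 : (i + p) / (p:ℤ) = i / p + 1 := Int.add_ediv_of_dvd_right (dvd_refl _) |>.trans (by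
      rw [Int.ediv_self hp'.ne'])
    have e2 : (i + p) % (p:ℤ) = i % p := by simp
    simp only [e1, e2, tz, Prod.mk.injEq]
    constructor <;> ring

lemma tz_supp {m n : ℕ} {A : Mat} (hA : IsGAP m n A) (a : ℤ) (c : Cell) (hc : c ∈ supp A) :
    tz m n a c ∈ supp A := by
  have key : ∀ (k : ℕ) (i j : ℤ), A (i + k * m) (j + k * n) = A i j := by
    intro k
    induction k with
    | zero => intro i j; simp
    | succ k ih =>
      intro i j
      rw [← ih i j, ← hA.1 (i + k * m)]
      push_cast
      congr 1 <;> ring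
  show A (c.1 + a * m) (c.2 + a * n) ≠ 0
  rcases Int.eq_nat_or_neg a with ⟨k, rfl | rfl⟩
  · rw [key]; exact hc
  · rw [← key k]
    simpa using (show A c.1 c.2 ≠ 0 from hc)

lemma closed_bound {m n : ℕ} {A : Mat} (hA : IsGAP m n A) {l : ℕ}
    (hmax : ∀ (S : Set Cell) (l' : ℕ), IsStream m n S l' → S ⊆ supp A → l' ≤ l) (a : ℕ) :
    ∀ (p : ℕ) (x : Cell), Reach (supp A) p x (tz m n ((a : ℤ) + 1) x) → p ≤ (a + 1) * l := by
  have stream : ∀ (p : ℕ) (x : Cell), Reach (supp A) p x (tz m n 1 x) → p ≤ l := by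
    intro p x h
    rcases Nat.eq_zero_or_pos p with rfl | hp
    · exact Nat.zero_le _
    obtain ⟨c, cS, cN, cp⟩ := exists_closed (tz_supp hA) hp h
    refine hmax (Set.range c) p ⟨c, ⟨hp, cN, fun i => ?_⟩, rfl⟩ ?_
    · rw [cp]; simp [tz, tauC]
    · rintro _ ⟨i, rfl⟩; exact cS i
  induction a with
  | zero => intro p x h; simpa using stream p x (by simpa using h)
  | succ a ih =>
    intro p x h
    by_contra! hlt
    have hp : 0 < p := by omega
    obtain ⟨c, cS, cN, cp⟩ := exists_closed (tz_supp hA) hp h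
    have hlp : (a + 1) * l + l < p := by nlinarith
    -- the dichotomy
    have dich : ∀ i : ℤ, (c i).1 + m ≤ (c (i + l)).1 ∨ (c i).2 + n ≤ (c (i + l)).2 := by
      intro i
      by_contra! hc
      have : Reach (supp A) (l + 1) (c i) (tz m n 1 (c i)) :=
        ⟨_, reach_seq c cS cN i l, ⟨by simpa [tz] using hc.1, by simpa [tz] using hc.2⟩,
          tz_supp hA _ _ (cS i)⟩
      have := stream _ _ this
      omega
    -- crossing
    have cross : ∀ i : ℤ, ¬ NW (tz m n 1 (c i)) (c (i + l + 1)) := by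
      intro i hc
      have r1 := reach_seq c cS cN (i + l + 1) (p - l - 1)
      rw [show i + l + 1 + ((p - l - 1 : ℕ) : ℤ) = i + p by omega, cp] at r1
      have : Reach (supp A) (p - l - 1 + 1) (c (i + l + 1))
          (tz m n ((a : ℤ) + 1) (c (i + l + 1))) := by
        refine ⟨_, r1, ?_, tz_supp hA _ _ (cS _)⟩
        obtain ⟨t1, t2⟩ := hc
        simp only [tz, NW] at t1 t2 ⊢
        push_cast
        constructor <;> linarith
      have := ih _ _ this
      omega
    have big : ∀ i : ℤ, (c (i + ((a + 1 + 1) * l : ℕ))).1 < (c i).1 + ((a:ℤ) + 1 + 1) * m ∧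
        (c (i + ((a + 1 + 1) * l : ℕ))).2 < (c i).2 + ((a:ℤ) + 1 + 1) * n := by
      intro i
      have := seq_lt c cN (i := i + ((a + 1 + 1) * l : ℕ)) (j := i + p) (by omega)
      rw [cp] at this
      simpa [NW, tz] using this
    -- some i fails the row condition
    have hex : ∃ i : ℤ, ¬ (c i).1 + m ≤ (c (i + l)).1 := by
      by_contra! hall
      have : ∀ t : ℕ, (c 0).1 + t * m ≤ (c (0 + (t * l : ℕ))).1 := by
        intro t
        induction t with
        | zero => simp
        | succ t iht =>
          have := hall (0 + (t * l : ℕ))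
          rw [show (0:ℤ) + ((t + 1) * l : ℕ) = 0 + (t * l : ℕ) + l by push_cast; ring]
          push_cast at *
          linarith
      have h1 := this (a + 1 + 1)
      have h2 := (big 0).1
      push_cast at h1 h2
      linarith
    obtain ⟨i, hi⟩ := hex
    have hnR : ∀ k : ℕ, ¬ (c (i + k)).1 + m ≤ (c (i + k + l)).1 := by
      intro k
      induction k with
      | zero => simpa using hi
      | succ k ihk =>
        intro hR
        have hK := (dich (i + k)).resolve_left ihk
        apply cross (i + k)
        have s1 := cN (i + k)
        have s2 := cN (i + k + l)
        rw [show i + ((k + 1 : ℕ) : ℤ) = i + k + 1 by push_cast; ring,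
          show i + (k : ℤ) + 1 + l = i + k + l + 1 by ring] at hR
        obtain ⟨s11, s12⟩ := s1
        obtain ⟨s21, s22⟩ := s2
        simp only [tz, NW]
        constructor <;> linarith
    have : ∀ t : ℕ, (c i).2 + t * n ≤ (c (i + (t * l : ℕ))).2 := by
      intro t
      induction t with
      | zero => simp
      | succ t iht =>
        have := (dich (i + (t * l : ℕ))).resolve_left (hnR (t * l))
        rw [show i + ((t + 1) * l : ℕ) = i + (t * l : ℕ) + l by push_cast; ring]
        push_cast at *
        linarith
    have h1 := this (a + 1 + 1)
    have h2 := (big i).2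
    push_cast at h1 h2
    linarith

/-- A chain of `k` steps between channel elements `e i` and `e j` has `k ≤ j - i`. -/
lemma channel_chain {m n : ℕ} {A : Mat} (hA : IsGAP m n A) {l : ℕ}
    (hmax : ∀ (S : Set Cell) (l' : ℕ), IsStream m n S l' → S ⊆ supp A → l' ≤ l)
    (e : ℤ → Cell) (he : IsStreamEnum m n e l) (heS : ∀ i, e i ∈ supp A)
    (k : ℕ) (i j : ℤ) (h : Reach (supp A) k (e i) (e j)) : i + k ≤ j := by
  obtain ⟨hl, eN, et⟩ := he
  have etz : ∀ (a : ℕ) (i : ℤ), e (i + a * l) = tz m n a (e i) := by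
    intro a
    induction a with
    | zero => intro i; simp [tz]
    | succ a ih =>
      intro i
      rw [show i + ((a + 1 : ℕ) : ℤ) * l = (i + a * l) + l by push_cast; ring, ← et, ih]
      simp only [tz, tauC, Prod.mk.injEq]
      push_cast
      constructor <;> ring
  -- choose a large
  obtain ⟨a, ha⟩ : ∃ a : ℕ, j ≤ i + (a + 1 : ℕ) * l := by
    refine ⟨(j - i).toNat, ?_⟩
    have : j - i ≤ (j - i).toNat := Int.self_le_toNat _
    have hl' : (1:ℤ) ≤ l := by exact_mod_cast hl
    push_cast
    nlinarith
  have r2 := reach_seq e heS eN j (i + (a + 1 : ℕ) * l - j).toNat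
  rw [show j + ((i + (a + 1 : ℕ) * l - j).toNat : ℤ) = i + (a + 1 : ℕ) * l by omega, etz] at r2
  have := h.tr _ _ r2
  push_cast at this
  have := closed_bound hA hmax a _ _ this
  zify at this
  rw [Int.toNat_of_nonneg (by push_cast at ha; linarith)] at this
  linarith

lemma chainSet_reach {A : Mat} {e : ℤ → Cell} {c : Cell} {v : ℤ} (h : v ∈ chainSet A e c) :
    ∃ (k : ℕ) (idx : ℤ), Reach (supp A) k (e idx) c ∧ v = idx + k := by
  obtain ⟨k, ch, h0, hS, hN, idx, hidx, hv⟩ := h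
  refine ⟨k, idx, ?_, hv⟩
  have : ∀ t : ℕ, t ≤ k → Reach (supp A) t (ch k) (ch (k - t)) := by
    intro t
    induction t with
    | zero => intro _; exact ⟨rfl, hS k le_rfl⟩
    | succ t ih =>
      intro ht
      refine ⟨_, ih (by omega), ?_, hS _ (by omega)⟩
      have := hN (k - (t + 1)) (by omega)
      rwa [show k - (t + 1) + 1 = k - t by omega] at this
  have := this k le_rfl
  rwa [Nat.sub_self, h0, ← hidx] at this

lemma reach_chainSet {A : Mat} {e : ℤ → Cell} {c : Cell} {k : ℕ} {idx : ℤ}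
    (h : Reach (supp A) k (e idx) c) : idx + (k : ℤ) ∈ chainSet A e c := by
  obtain ⟨f, f0, fk, fS, fN⟩ := h.fn
  refine ⟨k, fun i => f (k - i), by simpa using fk, fun i _ => fS _ (by omega), ?_, idx,
    by simpa using f0.symm, rfl⟩
  intro i hi
  have := fN (k - (i + 1)) (by omega)
  rwa [show k - (i + 1) + 1 = k - i by omega] at this

/-- For every nonzero `A ∈ M̂_{m×n}` and every channel `C` of
`A` (enumerated by `e`), the channel numbering `d^C_A` is well defined: for
every `c ∈ supp A` the defining set of chain values has a greatest element,
and the resulting numbering is proper; moreover `d^C_A = d₀` on `C`. -/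
theorem channel_numbering_well_defined_and_proper (m n : ℕ)
    (hm : 0 < m) (hn : 0 < n)
    (A : Mat) (hA : IsGAP m n A) (hA0 : A ≠ 0)
    (C : Set Cell) (hC : IsChannel m n A C)
    (e : ℤ → Cell) (l : ℕ) (he : IsStreamEnum m n e l) (hrange : Set.range e = C) :
    ∃ d : Cell → ℤ,
      IsChannelNumbering A e d ∧ IsProper A d ∧ ∀ i : ℤ, d (e i) = i := by
  obtain ⟨l₀, ⟨e', ⟨hl', eN', et'⟩, hr'⟩, hCS, hmax'⟩ := hC
  have heS : ∀ i, e i ∈ supp A := fun i => hCS (hrange ▸ Set.mem_range_self i)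
  have eN := he.2.1
  have hl₀ : l₀ ≤ l := by
    have hφ : ∀ k : ℤ, ∃ j, e j = e' k := fun k => by
      have : e' k ∈ Set.range e := by rw [hrange, ← hr']; exact Set.mem_range_self k
      exact this
    choose φ hφ using hφ
    have hstep : ∀ k, φ k + 1 ≤ φ (k + 1) := fun k => by
      have := eN' k
      rw [← hφ, ← hφ, seq_lt_iff e eN] at this
      exact this
    have hk : ∀ k : ℕ, φ 0 + k ≤ φ k := by
      intro k
      induction k with
      | zero => simp
      | succ k ih => have := hstep k; push_cast; linarith
    have h1 := et' 0
    rw [zero_add, ← hφ, ← hφ, he.2.2] at h1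
    have h2 := seq_inj e eN h1
    have h3 := hk l₀
    omega
  have hmax : ∀ (S : Set Cell) (l' : ℕ), IsStream m n S l' → S ⊆ supp A → l' ≤ l :=
    fun S l' h1 h2 => (hmax' S l' h1 h2).trans hl₀
  have key := channel_chain hA hmax e he heS
  have hgr : ∀ c : Cell, ∃ v : ℤ, c ∈ supp A → IsGreatest (chainSet A e c) v := by
    intro c
    by_cases hc : c ∈ supp A
    swap
    · exact ⟨0, fun h => absurd h hc⟩
    have hbd : ∃ b : ℤ, ∀ z : ℤ, z ∈ chainSet A e c → z ≤ b := by
      set J : ℕ := (max (c.1 - (e 0).1) (c.2 - (e 0).2)).toNat + 1 with hJ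
      have hm := seq_mono e eN 0 J
      have hNW : NW c (e (0 + J)) := by constructor <;> omega
      refine ⟨0 + J, fun z hz => ?_⟩
      obtain ⟨k, idx, hr, rfl⟩ := chainSet_reach hz
      have := key (k + 1) idx (0 + J) ⟨c, hr, hNW, heS _⟩
      push_cast at this
      omega
    have hne : ∃ z : ℤ, z ∈ chainSet A e c := by
      set J : ℕ := (max ((e 0).1 - c.1) ((e 0).2 - c.2)).toNat + 1 with hJ
      have hm := seq_mono e eN (-J) J
      rw [show (-(J:ℤ)) + J = 0 by ring] at hm
      have hNW : NW (e (-J)) c := by constructor <;> omega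
      exact ⟨_, reach_chainSet (k := 1) ⟨_, ⟨rfl, heS _⟩, hNW, hc⟩⟩
    obtain ⟨v, hv, hv'⟩ := Int.exists_greatest_of_bdd hbd hne
    exact ⟨v, fun _ => ⟨hv, fun z hz => hv' z hz⟩⟩
  choose d hd using hgr
  have hde : ∀ i, d (e i) = i := by
    intro i
    apply le_antisymm
    · obtain ⟨k, idx, hr, hv⟩ := chainSet_reach (hd _ (heS i)).1
      rw [hv]
      exact key k idx i hr
    · have := (hd _ (heS i)).2 (reach_chainSet (k := 0) (idx := i) ⟨rfl, heS i⟩)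
      simpa using this
  have hlt : ∀ c₁ ∈ supp A, ∀ c₂ ∈ supp A, NW c₂ c₁ → d c₂ < d c₁ := by
    intro c₁ h1 c₂ h2 h
    obtain ⟨k, idx, hr, hv⟩ := chainSet_reach (hd _ h2).1
    have := (hd _ h1).2 (reach_chainSet (k := k + 1) (idx := idx) ⟨c₂, hr, h, h1⟩)
    push_cast at this
    omega
  refine ⟨d, fun c hc => hd c hc, ⟨hlt, ?_⟩, hde⟩
  intro c₁ h1
  obtain ⟨k, idx, hr, hv⟩ := chainSet_reach (hd _ h1).1
  cases k with
  | zero =>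
    obtain ⟨rfl, _⟩ := hr
    refine ⟨e (idx - 1), heS _, seq_lt e eN (by omega), ?_⟩
    rw [hde, hde]
  | succ k =>
    obtain ⟨z, hz, hN, _⟩ := hr
    refine ⟨z, hz.mem, hN, ?_⟩
    have h3 := hlt c₁ h1 z hz.mem hN
    have h4 := (hd _ hz.mem).2 (reach_chainSet hz)
    push_cast at hv
    omega


end AffineRSK
end
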